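/- arXiv:2403.00500 — 3 statements merged into one kernel-verified Lean document; each statement's English description precedes it below -/
import Mathlib

section
/- Let β be an algebraic number of degree n ≥ 5 over ℚ with conjugates β_1, …, β_n, and assume Gal(ℚ(β_1,…,β_n)/ℚ) = 𝔄_n. Let a_1, …, a_n ∈ ℤ and set α = β_1^{a_1} ⋯ β_n^{a_n}. Then α generates ℚ(β_1,…,β_n) over ℚ (i.e., ℚ(α) = ℚ(β_1,…,β_n)) if and only if there are at most two distinct indices i, j with a_i = a_j (equivalently, the values a_1,…,a_n take at least n−1 distinct values). -/
open Polynomial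

/-- The set of permutations of the roots induced by field automorphisms fixing `ℚ`,
i.e. the image of the permutation representation of the Galois group of the splitting
field on the roots `B 0, …, B (n-1)`. -/
def galoisImage (n : ℕ) (B : Fin n → ℂ) : Set (Equiv.Perm (Fin n)) :=
  {τ | ∃ σ : ℂ ≃ₐ[ℚ] ℂ, ∀ i, σ (B i) = B (τ i)}

theorem ext_aut (K : IntermediateField ℚ ℂ) (σ : K ≃ₐ[ℚ] K) :
    ∃ τ : ℂ ≃ₐ[ℚ] ℂ, ∀ x : K, τ x = σ x := by
  obtain ⟨s, hs⟩ := exists_isTranscendenceBasis K ℂ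
  letI := IsAlgClosed.isAlgClosure_of_transcendence_basis _ hs
  let e : Algebra.adjoin K (Set.range ((↑) : s → ℂ)) ≃+*
      Algebra.adjoin K (Set.range ((↑) : s → ℂ)) :=
    hs.1.aevalEquiv.symm.toRingEquiv.trans
      ((MvPolynomial.mapEquiv s σ.toRingEquiv).trans hs.1.aevalEquiv.toRingEquiv)
  let E : ℂ ≃+* ℂ := IsAlgClosure.equivOfEquiv ℂ ℂ e
  have hE : ∀ x : K, E x = σ x := by
    intro x
    have h := IsAlgClosure.equivOfEquiv_algebraMap ℂ ℂ e
      (algebraMap K (Algebra.adjoin K (Set.range ((↑) : s → ℂ))) x)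
    have h2 : e (algebraMap K (Algebra.adjoin K (Set.range ((↑) : s → ℂ))) x) =
        algebraMap K (Algebra.adjoin K (Set.range ((↑) : s → ℂ))) (σ x) := by
      have h3 : hs.1.aevalEquiv.symm (algebraMap K _ x) = MvPolynomial.C x :=
        AlgEquiv.commutes _ x
      have h4 : hs.1.aevalEquiv (MvPolynomial.C (σ x)) = algebraMap K _ (σ x) :=
        AlgEquiv.commutes _ (σ x)
      change hs.1.aevalEquiv (MvPolynomial.mapEquiv s σ.toRingEquiv
        (hs.1.aevalEquiv.symm (algebraMap K _ x))) = _
      rw [h3, ← h4]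
      simp
    rw [h2] at h
    exact h
  exact ⟨AlgEquiv.ofRingEquiv (f := E) (fun q => by simp), hE⟩

/-- three-cycle -/
def cyc {n : ℕ} (x y z : Fin n) : Equiv.Perm (Fin n) := Equiv.swap x y * Equiv.swap y z

theorem cyc_mem {n : ℕ} {x y z : Fin n} (h1 : x ≠ y) (h2 : y ≠ z) :
    cyc x y z ∈ alternatingGroup (Fin n) := by
  simp [cyc, Equiv.Perm.mem_alternatingGroup, Equiv.Perm.sign_swap, h1, h2]

theorem cyc_apply {n : ℕ} {x y z : Fin n} (h1 : x ≠ y) (h2 : y ≠ z) (h3 : x ≠ z) (i : Fin n) :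
    cyc x y z i = if i = x then y else if i = y then z else if i = z then x else i := by
  simp only [cyc, Equiv.Perm.mul_apply, Equiv.swap_apply_def]
  grind

theorem exists_five {n : ℕ} (hn : 5 ≤ n) (p q : Fin n) (hpq : p ≠ q) :
    ∃ r s t : Fin n, r ≠ p ∧ r ≠ q ∧ s ≠ p ∧ s ≠ q ∧ s ≠ r ∧ t ≠ p ∧ t ≠ q ∧ t ≠ r ∧ t ≠ s := by
  have key : ∀ S : Finset (Fin n), S.card < 5 → ∃ x, x ∉ S := by
    intro S hS
    by_contra! h
    have : S = Finset.univ := Finset.eq_univ_iff_forall.2 h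
    rw [this, Finset.card_univ, Fintype.card_fin] at hS
    omega
  obtain ⟨r, hr⟩ := key {p, q} (lt_of_le_of_lt Finset.card_le_two (by norm_num))
  obtain ⟨s, hs⟩ := key {p, q, r} (lt_of_le_of_lt Finset.card_le_three (by norm_num))
  obtain ⟨t, ht⟩ := key {p, q, r, s} (lt_of_le_of_lt Finset.card_le_four (by norm_num))
  simp at hr hs ht
  exact ⟨r, s, t, by tauto⟩

theorem aut_pow (σ : ℂ ≃ₐ[ℚ] ℂ) (z : ℂ) (N : ℕ) (hN : N ≠ 0) (hz : z ^ N = 1) :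
    ∃ k : ℕ, σ z = z ^ k := by
  haveI : NeZero N := ⟨hN⟩
  obtain ⟨m, hm⟩ := map_rootsOfUnity_eq_pow_self σ (rootsOfUnity.mkOfPowEq z hz)
  exact ⟨m, by simpa using hm⟩

theorem no_root {n : ℕ} (hn : 5 ≤ n) (B : Fin n → ℂ) (hinj : Function.Injective B)
    (hne : ∀ i, B i ≠ 0)
    (hA : ∀ τ ∈ alternatingGroup (Fin n), ∃ σ : ℂ ≃ₐ[ℚ] ℂ, ∀ i, σ (B i) = B (τ i))
    (p t : Fin n) (hpt : p ≠ t) (N : ℕ) (hN : N ≠ 0) (hz : (B p / B t) ^ N = 1) : False := by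
  obtain ⟨q, r, s, h⟩ := exists_five hn p t hpt
  obtain ⟨h1, h2, h3, h4, h5, h6, h7, h8, h9⟩ := h
  obtain ⟨σ, hσ⟩ := hA _ (cyc_mem (x := p) (y := q) (z := r) h1.symm h5.symm)
  obtain ⟨τ, hτ⟩ := hA _ (cyc_mem (x := q) (y := r) (z := s) h5.symm h9.symm)
  obtain ⟨k, hk⟩ := aut_pow σ _ N hN hz
  obtain ⟨l, hl⟩ := aut_pow τ _ N hN hz
  have hc : σ (τ (B p / B t)) = τ (σ (B p / B t)) := by
    rw [hk, hl, map_pow, map_pow, hk, hl, ← pow_mul, ← pow_mul, mul_comm]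
  simp only [map_div₀, hσ, hτ] at hc
  have e1 : cyc p q r (cyc q r s p) = q := by
    rw [cyc_apply h5.symm h9.symm h8.symm, cyc_apply h1.symm h5.symm h3.symm]; grind
  have e2 : cyc p q r (cyc q r s t) = t := by
    rw [cyc_apply h5.symm h9.symm h8.symm, cyc_apply h1.symm h5.symm h3.symm]; grind
  have e3 : cyc q r s (cyc p q r p) = r := by
    rw [cyc_apply h5.symm h9.symm h8.symm, cyc_apply h1.symm h5.symm h3.symm]; grind
  have e4 : cyc q r s (cyc p q r t) = t := by
    rw [cyc_apply h5.symm h9.symm h8.symm, cyc_apply h1.symm h5.symm h3.symm]; grind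
  rw [e1, e2, e3, e4, div_left_inj' (hne t)] at hc
  exact h5 (hinj hc).symm

theorem no_rel {n : ℕ} (hn : 5 ≤ n) (B : Fin n → ℂ) (hinj : Function.Injective B)
    (hne : ∀ i, B i ≠ 0)
    (hA : ∀ τ ∈ alternatingGroup (Fin n), ∃ σ : ℂ ≃ₐ[ℚ] ℂ, ∀ i, σ (B i) = B (τ i))
    (c : Fin n → ℤ) (p q : Fin n) (hc : c p ≠ c q) (hR : ∏ i, B i ^ c i = 1) : False := by
  have hpq : p ≠ q := fun h => hc (h ▸ rfl)
  have step : ∀ c : Fin n → ℤ, ∏ i, B i ^ c i = 1 → ∀ τ ∈ alternatingGroup (Fin n),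
      ∏ i, B i ^ (c i - c (τ i)) = 1 := by
    intro c hR τ hτ
    obtain ⟨σ, hσ⟩ := hA _ (inv_mem hτ)
    have h := congrArg σ hR
    simp only [map_prod, map_zpow₀, hσ, map_one] at h
    rw [← Equiv.prod_comp τ] at h
    have hi : ∀ i, τ⁻¹ (τ i) = i := fun i => τ.symm_apply_apply i
    simp only [hi] at h
    simp only [zpow_sub₀ (hne _), Finset.prod_div_distrib, hR, h, div_one]
  obtain ⟨r, s, t, h⟩ := exists_five hn p q hpq
  obtain ⟨h1, h2, h3, h4, h5, h6, h7, h8, h9⟩ := h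
  have hR2 := step _ (step c hR _ (cyc_mem (x := p) (y := q) (z := r) hpq h2.symm))
    _ (cyc_mem (x := p) (y := s) (z := t) h3.symm h9.symm)
  have hval : ∀ i, (c i - c (cyc p q r i) - (c (cyc p s t i) - c (cyc p q r (cyc p s t i)))) =
      if i = p then c p - c q else if i = t then -(c p - c q) else 0 := by
    intro i
    simp only [cyc_apply hpq h2.symm h1.symm, cyc_apply h3.symm h9.symm h6.symm]
    grind
  simp only [hval] at hR2
  have h10 : B p ^ (c p - c q) * B t ^ (-(c p - c q)) = 1 := by
    rw [← hR2]
    rw [← Finset.prod_subset (Finset.subset_univ {p, t}), Finset.prod_pair h6.symm]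
    · simp [h6]
    · intro x _ hx
      simp at hx
      simp [hx]
  have h11 : (B p / B t) ^ (c p - c q) = 1 := by
    rw [div_zpow, ← h10, zpow_neg, div_eq_mul_inv]
  have h12 : (B p / B t) ^ (c p - c q).natAbs = 1 := by
    rcases Int.natAbs_eq (c p - c q) with h | h
    · rw [h, zpow_natCast] at h11; exact h11
    · rw [h, zpow_neg, zpow_natCast, inv_eq_one] at h11; exact h11
  exact no_root hn B hinj hne hA p t h6.symm _ (by omega) h12

theorem comb1 {n : ℕ} (a : Fin n → ℤ) (h : (Finset.univ.image a).card < n - 1) :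
    ∃ τ ∈ alternatingGroup (Fin n), (∀ i, a (τ i) = a i) ∧ ∃ j, τ j ≠ j := by
  have h0 : ∃ i ∈ (Finset.univ : Finset (Fin n)), ∃ j ∈ (Finset.univ : Finset (Fin n)),
      i ≠ j ∧ a i = a j := by
    apply Finset.exists_ne_map_eq_of_card_lt_of_maps_to (t := Finset.univ.image a)
    · simp; omega
    · intro x _; simp
  obtain ⟨i, -, j, -, hij, haij⟩ := h0
  have h1 : ∃ k ∈ (Finset.univ : Finset (Fin n)).erase j, ∃ l ∈ Finset.univ.erase j,
      k ≠ l ∧ a k = a l := by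
    apply Finset.exists_ne_map_eq_of_card_lt_of_maps_to (t := Finset.univ.image a)
    · simpa [Finset.card_erase_of_mem] using h
    · intro x _; simp
  obtain ⟨k, hk, l, hl, hkl, hakl⟩ := h1
  simp at hk hl
  refine ⟨Equiv.swap i j * Equiv.swap k l, ?_, ?_, j, ?_⟩
  · simp [Equiv.Perm.mem_alternatingGroup, Equiv.Perm.sign_swap, hij, hkl]
  · intro x
    simp only [Equiv.Perm.mul_apply, Equiv.swap_apply_def]
    grind
  · simp only [Equiv.Perm.mul_apply, Equiv.swap_apply_def]
    grind

theorem comb2 {n : ℕ} (a : Fin n → ℤ) (h : n - 1 ≤ (Finset.univ.image a).card)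
    (τ : Equiv.Perm (Fin n)) (hτ : τ ∈ alternatingGroup (Fin n)) (ha : ∀ i, a (τ i) = a i) :
    τ = 1 := by
  have key : ∀ i j k l : Fin n, i ≠ j → a i = a j → k ≠ l → a k = a l → k = j ∨ l = j := by
    intro i j k l hij haij hkl hakl
    by_contra! hcon
    have himg : (Finset.univ.erase j).image a = Finset.univ.image a := by
      ext y
      simp only [Finset.mem_image, Finset.mem_erase, Finset.mem_univ, and_true, true_and]
      constructor
      · rintro ⟨x, _, hx⟩; exact ⟨x, hx⟩
      · rintro ⟨x, hx⟩
        by_cases hxj : x = j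
        · exact ⟨i, hij, by rw [haij, ← hxj, hx]⟩
        · exact ⟨x, hxj, hx⟩
    have hinj : Set.InjOn a (Finset.univ.erase j : Finset (Fin n)) := by
      rw [← Finset.card_image_iff, himg]
      apply le_antisymm
      · rw [← himg]; exact Finset.card_image_le
      · simpa [Finset.card_erase_of_mem] using h
    exact hkl (hinj (by simp [hcon.1]) (by simp [hcon.2]) hakl)
  by_contra hne
  obtain ⟨m, hm⟩ : ∃ m, τ m ≠ m := by
    by_contra! h; exact hne (Equiv.ext h)
  have hsup : ∀ x, τ x ≠ x → x = m ∨ x = τ m := by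
    intro x hx
    have k1 := key (τ x) x (τ m) m hx (ha x) hm (ha m)
    grind
  have hsw : τ = Equiv.swap m (τ m) := by
    ext1 x
    rw [Equiv.swap_apply_def]
    have k1 := hsup x
    have k2 := hsup (τ (τ m))
    have k3 := hsup (τ m)
    have k4 : τ (τ m) ≠ τ m := fun h => hm (τ.injective h)
    have k5 : τ (τ (τ m)) ≠ τ (τ m) := fun h => k4 (τ.injective h)
    grind
  rw [Equiv.Perm.mem_alternatingGroup, hsw, Equiv.Perm.sign_swap hm.symm] at hτ
  exact absurd hτ (by decide)

/-- Let `β` be an algebraic number of degree `n ≥ 5` with conjugates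
`B 0, …, B (n-1)` and Galois group of the splitting field equal to `𝔄ₙ`.  Then
`α = ∏ Bᵢ^{aᵢ}` generates `ℚ(B₀,…,Bₙ₋₁)` over `ℚ` iff the `aᵢ` take at least `n-1`
distinct values. -/
theorem stmt_1 (n : ℕ) (hn : 5 ≤ n) (b : ℂ) (B : Fin n → ℂ)
    (hb : IsIntegral ℚ b)
    (hdeg : (minpoly ℚ b).natDegree = n)
    (hroots : (minpoly ℚ b).aroots ℂ = Multiset.map B Finset.univ.val)
    (hgal : galoisImage n B = (alternatingGroup (Fin n) : Set (Equiv.Perm (Fin n))))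
    (a : Fin n → ℤ) (α : ℂ) (hα : α = ∏ i, B i ^ a i) :
    IntermediateField.adjoin ℚ {α} = IntermediateField.adjoin ℚ (Set.range B) ↔
      n - 1 ≤ (Finset.univ.image a).card := by
  have hirr : Irreducible (minpoly ℚ b) := minpoly.irreducible hb
  have hsep : (minpoly ℚ b).Separable := hirr.separable
  have hinj : Function.Injective B := by
    have h1 : ((minpoly ℚ b).aroots ℂ).Nodup := nodup_aroots_iff_of_splits hirr.ne_zero
      (IsAlgClosed.splits _) |>.2 hsep
    rw [hroots] at h1
    intro i j hij
    exact Multiset.inj_on_of_nodup_map h1 i (by simp) j (by simp) hij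
  have hset : (minpoly ℚ b).rootSet ℂ = Set.range B := by
    ext x
    rw [Polynomial.mem_rootSet', ← Polynomial.mem_aroots', hroots]
    simp
  have hrt : ∀ i, Polynomial.aeval (B i) (minpoly ℚ b) = 0 := by
    intro i
    have : B i ∈ (minpoly ℚ b).rootSet ℂ := hset ▸ Set.mem_range_self i
    exact Polynomial.aeval_eq_zero_of_mem_rootSet this
  have hne : ∀ i, B i ≠ 0 := by
    intro i h0
    have h1 := hrt i
    have h2 : minpoly ℚ b = minpoly ℚ (B i) :=
      minpoly.eq_of_irreducible_of_monic hirr h1 (minpoly.monic hb)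
    rw [h2, h0, minpoly.zero, natDegree_X] at hdeg
    omega
  have hA : ∀ τ ∈ alternatingGroup (Fin n), ∃ σ : ℂ ≃ₐ[ℚ] ℂ, ∀ i, σ (B i) = B (τ i) := by
    intro τ hτ
    have : τ ∈ galoisImage n B := by rw [hgal]; exact hτ
    exact this
  have hαK : α ∈ IntermediateField.adjoin ℚ (Set.range B) := by
    rw [hα]
    have h1 : ∀ i, B i ∈ IntermediateField.adjoin ℚ (Set.range B) :=
      fun i => IntermediateField.subset_adjoin _ _ (Set.mem_range_self i)
    exact prod_mem fun i _ => zpow_mem (h1 i) _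
  constructor
  · intro hK
    by_contra! hlt
    obtain ⟨τ, hτ, ha, j, hj⟩ := comb1 a hlt
    obtain ⟨σ, hσ⟩ := hA τ hτ
    have hσα : σ α = α := by
      rw [hα]
      simp only [map_prod, map_zpow₀, hσ]
      rw [← Equiv.prod_comp τ (fun i => B i ^ a i)]
      simp only [ha]
    have hmem : B j ∈ IntermediateField.adjoin ℚ {α} := by
      rw [hK]; exact IntermediateField.subset_adjoin _ _ ⟨j, rfl⟩
    have hle : IntermediateField.adjoin ℚ {α} ≤ IntermediateField.fixedField
        (Subgroup.zpowers σ) := by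
      rw [IntermediateField.adjoin_simple_le_iff, IntermediateField.mem_fixedField_iff]
      intro f hf
      have : Subgroup.zpowers σ ≤ MulAction.stabilizer (ℂ ≃ₐ[ℚ] ℂ) α := by
        rw [Subgroup.zpowers_le]; exact hσα
      exact this hf
    have := (IntermediateField.mem_fixedField_iff _ _).1 (hle hmem) σ
      (Subgroup.mem_zpowers σ)
    rw [hσ] at this
    exact hj (hinj this)
  · intro hcard
    have hfix : ∀ σ : ℂ ≃ₐ[ℚ] ℂ, σ α = α → ∀ i, σ (B i) = B i := by
      intro σ hσ
      have hex : ∀ i, ∃ j, σ (B i) = B j := by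
        intro i
        have : σ (B i) ∈ (minpoly ℚ b).rootSet ℂ := by
          rw [Polynomial.mem_rootSet]
          refine ⟨hirr.ne_zero, ?_⟩
          rw [Polynomial.aeval_algHom_apply, hrt, map_zero]
        rw [hset] at this
        obtain ⟨j, hj⟩ := this
        exact ⟨j, hj.symm⟩
      choose f hf using hex
      have hfinj : Function.Injective f := by
        intro i j hij
        apply hinj
        apply σ.injective
        rw [hf, hf, hij]
      let τ : Equiv.Perm (Fin n) := Equiv.ofBijective f (Finite.injective_iff_bijective.1 hfinj)
      have hτ : ∀ i, σ (B i) = B (τ i) := hf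
      have hτA : τ ∈ alternatingGroup (Fin n) := by
        have : τ ∈ galoisImage n B := ⟨σ, hτ⟩
        rw [hgal] at this; exact this
      have hinv : ∀ i, a (τ i) = a i := by
        by_contra! hcon
        obtain ⟨i₀, hi₀⟩ := hcon
        have hrel : ∏ i, B i ^ (a i - a (τ⁻¹ i)) = 1 := by
          have h1 := hσ
          rw [hα] at h1
          simp only [map_prod, map_zpow₀, hτ] at h1
          have h2 : ∏ i, B i ^ a (τ⁻¹ i) = ∏ i, B (τ i) ^ a i := by
            rw [← Equiv.prod_comp τ]
            simp
          simp only [zpow_sub₀ (hne _), Finset.prod_div_distrib, h2, h1]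
          exact div_self (Finset.prod_ne_zero_iff.2 fun i _ => zpow_ne_zero _ (hne i))
        have hsum : ∑ i, (a i - a (τ⁻¹ i)) = 0 := by
          rw [Finset.sum_sub_distrib, Equiv.sum_comp τ⁻¹ a, sub_self]
        by_cases hcst : ∃ q, a (τ i₀) - a (τ⁻¹ (τ i₀)) ≠ a q - a (τ⁻¹ q)
        · obtain ⟨q, hq⟩ := hcst
          exact no_rel hn B hinj hne hA (fun i => a i - a (τ⁻¹ i)) (τ i₀) q hq hrel
        · push Not at hcst
          rw [Finset.sum_congr rfl (fun q _ => (hcst q).symm)] at hsum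
          have hi : τ⁻¹ (τ i₀) = i₀ := τ.symm_apply_apply i₀
          rw [hi, Finset.sum_const, Finset.card_univ, Fintype.card_fin, smul_eq_zero] at hsum
          omega
      have h1 := comb2 a hcard τ hτA hinv
      intro i
      rw [hτ, h1]; rfl
    apply le_antisymm
    · rw [IntermediateField.adjoin_simple_le_iff]; exact hαK
    · haveI : (minpoly ℚ b).IsSplittingField ℚ
          (IntermediateField.adjoin ℚ (Set.range B)) := by
        rw [← hset]
        exact IntermediateField.adjoin_rootSet_isSplittingField (IsAlgClosed.splits _)
      haveI : IsGalois ℚ (IntermediateField.adjoin ℚ (Set.range B)) :=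
        IsGalois.of_separable_splitting_field hsep
      haveI : FiniteDimensional ℚ (IntermediateField.adjoin ℚ (Set.range B)) :=
        Polynomial.IsSplittingField.finiteDimensional _ (minpoly ℚ b)
      set K := IntermediateField.adjoin ℚ (Set.range B) with hKdef
      have htop : IntermediateField.adjoin ℚ {(⟨α, hαK⟩ : K)} = ⊤ := by
        rw [← IsGalois.fixedField_fixingSubgroup
          (IntermediateField.adjoin ℚ {(⟨α, hαK⟩ : K)})]
        rw [← IntermediateField.fixedField_bot (F := ℚ) (E := K)]
        congr 1
        rw [eq_bot_iff]
        intro σ hσ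
        have hσα : σ ⟨α, hαK⟩ = ⟨α, hαK⟩ :=
          hσ ⟨_, IntermediateField.mem_adjoin_simple_self ℚ _⟩
        obtain ⟨τ, hτ⟩ := ext_aut K σ
        have h1 := hfix τ (by rw [hτ ⟨α, hαK⟩, hσα])
        have hle : K ≤ IntermediateField.fixedField (Subgroup.zpowers τ) := by
          rw [hKdef, IntermediateField.adjoin_le_iff]
          rintro _ ⟨i, rfl⟩
          rw [SetLike.mem_coe, IntermediateField.mem_fixedField_iff]
          intro f hf
          have : Subgroup.zpowers τ ≤ MulAction.stabilizer (ℂ ≃ₐ[ℚ] ℂ) (B i) := by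
            rw [Subgroup.zpowers_le]; exact h1 i
          exact this hf
        rw [Subgroup.mem_bot]
        ext x
        rw [← hτ]
        exact (IntermediateField.mem_fixedField_iff _ _).1 (hle x.2) τ
          (Subgroup.mem_zpowers τ)
      have h2 := congrArg (IntermediateField.map K.val) htop
      have h3 := IntermediateField.adjoin_map ℚ {(⟨α, hαK⟩ : K)} K.val
      have h4 : IntermediateField.map K.val ⊤ = K := by
        rw [← AlgHom.fieldRange_eq_map, IntermediateField.fieldRange_val]
      have h5 := h3.symm.trans (h2.trans h4)
      rw [Set.image_singleton] at h5
      exact h5.ge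
end

section
/- Let n ≥ 5. For every x, y ∈ H_n one has c_n · |x|_1 · |y|_1 ≤ s_n(x,y) ≤ |x|_1 · |y|_1, where c_n is the constant defined in the context. -/
/-- `sₙ(x,y) = (2/n!) ∑_{σ ∈ 𝔄ₙ} |(1/n) ∑ⱼ x_{σ(j)} yⱼ|`. -/
noncomputable def snBil (n : ℕ) (x y : Fin n → ℝ) : ℝ :=
  (2 / (n.factorial : ℝ)) *
    ∑ σ : alternatingGroup (Fin n), |(1 / (n : ℝ)) * ∑ j, x ((σ : Equiv.Perm (Fin n)) j) * y j|

/-- The vector `z^{(n,h)}` with coordinates `n/(2h)` (first `h` coordinates) and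
`-n/(2(n-h))` (remaining coordinates). -/
noncomputable def zvec (n h : ℕ) : Fin n → ℝ :=
  fun j => if (j : ℕ) < h then (n : ℝ) / (2 * h) else -((n : ℝ) / (2 * ((n : ℝ) - h)))

/-- `cₙ = min_{0 < h,k < n} sₙ(z^{(n,h)}, z^{(n,k)})`. -/
noncomputable def cConst (n : ℕ) : ℝ :=
  sInf {r | ∃ h k : ℕ, 0 < h ∧ h < n ∧ 0 < k ∧ k < n ∧ r = snBil n (zvec n h) (zvec n k)}

/-- Unnormalised version of `snBil`. -/
noncomputable def SS (n : ℕ) (x y : Fin n → ℝ) : ℝ :=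
  ∑ σ : alternatingGroup (Fin n), |∑ j, x ((σ : Equiv.Perm (Fin n)) j) * y j|

lemma snBil_eq (n : ℕ) (x y : Fin n → ℝ) :
    snBil n x y = (2 / (n.factorial : ℝ)) * (1 / (n : ℝ)) * SS n x y := by
  unfold snBil SS
  rw [mul_assoc, Finset.mul_sum (a := 1 / (n : ℝ))]
  congr 1
  apply Finset.sum_congr rfl
  intro σ _
  rw [abs_mul, abs_of_nonneg (by positivity : (0 : ℝ) ≤ 1 / (n : ℝ))]

lemma SS_comp {n : ℕ} (x y : Fin n → ℝ) (τ : Equiv.Perm (Fin n))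
    (hτ : τ ∈ alternatingGroup (Fin n)) : SS n (fun j => x (τ j)) y = SS n x y := by
  unfold SS
  exact Equiv.sum_comp (Equiv.mulLeft (⟨τ, hτ⟩ : alternatingGroup (Fin n)))
    (fun σ : alternatingGroup (Fin n) => |∑ j, x ((σ : Equiv.Perm (Fin n)) j) * y j|)

lemma SS_symm {n : ℕ} (x y : Fin n → ℝ) : SS n x y = SS n y x := by
  unfold SS
  rw [← Equiv.sum_comp (Equiv.inv (alternatingGroup (Fin n)))]
  apply Finset.sum_congr rfl
  intro σ _
  congr 1
  rw [← Equiv.sum_comp (σ : Equiv.Perm (Fin n))]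
  apply Finset.sum_congr rfl
  intro j _
  simp [mul_comm]

lemma SS_smul {n : ℕ} (c : ℝ) (hc : 0 ≤ c) (x y : Fin n → ℝ) :
    SS n (fun j => c * x j) y = c * SS n x y := by
  unfold SS
  rw [Finset.mul_sum]
  apply Finset.sum_congr rfl
  intro σ _
  rw [← abs_of_nonneg hc, ← abs_mul, abs_of_nonneg hc, Finset.mul_sum]
  simp only [mul_assoc]

lemma SS_sum {n : ℕ} {ι : Type*} (G : Finset ι) (f : ι → Fin n → ℝ) (y : Fin n → ℝ) :
    SS n (fun j => ∑ g ∈ G, f g j) y ≤ ∑ g ∈ G, SS n (f g) y := by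
  unfold SS
  rw [Finset.sum_comm]
  apply Finset.sum_le_sum
  intro σ _
  refine le_trans (le_of_eq ?_) (Finset.abs_sum_le_sum_abs _ _)
  congr 1
  rw [Finset.sum_comm]
  simp only [Finset.sum_mul]

lemma SS_nonneg {n : ℕ} (x y : Fin n → ℝ) : 0 ≤ SS n x y :=
  Finset.sum_nonneg fun _ _ => abs_nonneg _

lemma exists_pair {n : ℕ} (hn : 5 ≤ n) (p : Fin n → Prop) (i i' : Fin n) :
    ∃ c d : Fin n, c ≠ d ∧ c ≠ i ∧ c ≠ i' ∧ d ≠ i ∧ d ≠ i' ∧ (p c ↔ p d) := by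
  classical
  have h1 : (Finset.univ : Finset Bool).card < (Finset.univ \ {i, i'} : Finset (Fin n)).card := by
    have h2 : ({i, i'} : Finset (Fin n)).card ≤ 2 := Finset.card_le_two
    have h3 := Finset.le_card_sdiff ({i, i'} : Finset (Fin n)) Finset.univ
    simp only [Finset.card_univ, Fintype.card_fin, Fintype.card_bool] at h3 ⊢
    omega
  obtain ⟨c, hc, d, hd, hcd, he⟩ := Finset.exists_ne_map_eq_of_card_lt_of_maps_to h1
    (f := fun j => decide (p j)) (fun a _ => Finset.mem_coe.2 (Finset.mem_univ _))
  simp only [Finset.mem_sdiff, Finset.mem_univ, true_and, Finset.mem_insert,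
    Finset.mem_singleton, not_or] at hc hd
  exact ⟨c, d, hcd, hc.1, hc.2, hd.1, hd.2, by simpa using he⟩

open Classical in
/-- Even permutations preserving the predicate `p`. -/
noncomputable def GG {n : ℕ} (p : Fin n → Prop) : Finset (Equiv.Perm (Fin n)) :=
  Finset.univ.filter fun σ => σ ∈ alternatingGroup (Fin n) ∧ ∀ j, p (σ j) ↔ p j

lemma mem_GG {n : ℕ} {p : Fin n → Prop} {σ : Equiv.Perm (Fin n)} :
    σ ∈ GG p ↔ σ ∈ alternatingGroup (Fin n) ∧ ∀ j, p (σ j) ↔ p j := by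
  simp [GG]

lemma swap_pres {n : ℕ} {p : Fin n → Prop} {a b : Fin n} (h : p a ↔ p b) (j : Fin n) :
    p (Equiv.swap a b j) ↔ p j := by
  rw [Equiv.swap_apply_def]
  split_ifs with h1 h2
  · rw [h1, h]
  · rw [h2, h]
  · rfl

lemma exists_GG {n : ℕ} (hn : 5 ≤ n) (p : Fin n → Prop) (i i' : Fin n) (h : p i ↔ p i') :
    ∃ τ ∈ GG p, τ i' = i := by
  by_cases hii : i = i'
  · exact ⟨1, mem_GG.2 ⟨one_mem _, fun j => by simp⟩, by simp [hii]⟩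
  obtain ⟨c, d, hcd, h1, h2, h3, h4, hp⟩ := exists_pair hn p i i'
  refine ⟨Equiv.swap i i' * Equiv.swap c d, mem_GG.2 ⟨?_, fun j => ?_⟩, ?_⟩
  · rw [Equiv.Perm.mem_alternatingGroup, Equiv.Perm.sign_mul, Equiv.Perm.sign_swap hii,
      Equiv.Perm.sign_swap hcd]
    rfl
  · rw [Equiv.Perm.mul_apply, swap_pres h, swap_pres hp]
  · rw [Equiv.Perm.mul_apply, Equiv.swap_apply_of_ne_of_ne h2.symm h4.symm,
      Equiv.swap_apply_right]

lemma GG_mul {n : ℕ} {p : Fin n → Prop} {σ τ : Equiv.Perm (Fin n)} (hσ : σ ∈ GG p)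
    (hτ : τ ∈ GG p) : σ * τ ∈ GG p := by
  rw [mem_GG] at *
  exact ⟨mul_mem hσ.1 hτ.1, fun j => by rw [Equiv.Perm.mul_apply, hσ.2, hτ.2]⟩

lemma GG_inv {n : ℕ} {p : Fin n → Prop} {σ : Equiv.Perm (Fin n)} (hσ : σ ∈ GG p) :
    σ⁻¹ ∈ GG p := by
  rw [mem_GG] at *
  exact ⟨inv_mem hσ.1, fun j => by rw [← hσ.2]; simp⟩

open Classical in
lemma avg_GG {n : ℕ} (hn : 5 ≤ n) (p : Fin n → Prop) (f : Fin n → ℝ) (i : Fin n) :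
    ((Finset.univ.filter fun j => p j ↔ p i).card : ℝ) * ∑ g ∈ GG p, f (g i) =
      ((GG p).card : ℝ) * ∑ j ∈ Finset.univ.filter (fun j => p j ↔ p i), f j := by
  have h1 : ∀ j ∈ Finset.univ.filter (fun j => p j ↔ p i),
      ∑ g ∈ GG p, f (g j) = ∑ g ∈ GG p, f (g i) := by
    intro j hj
    obtain ⟨τ, hτ, hτi⟩ := exists_GG hn p j i (by simpa using hj)
    refine Finset.sum_bij' (fun g _ => g * τ) (fun g _ => g * τ⁻¹)
      (fun g hg => GG_mul hg hτ) (fun g hg => GG_mul hg (GG_inv hτ)) ?_ ?_ ?_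
    · intro g _; simp
    · intro g _; simp
    · intro g _; simp [hτi]
  have h2 : ∀ g ∈ GG p, ∑ j ∈ Finset.univ.filter (fun j => p j ↔ p i), f (g j) =
      ∑ j ∈ Finset.univ.filter (fun j => p j ↔ p i), f j := by
    intro g hg
    have hg' := (mem_GG.1 hg).2
    refine Finset.sum_bij' (fun j _ => g j) (fun j _ => g⁻¹ j) ?_ ?_ ?_ ?_ ?_
    · intro j hj; simpa [hg'] using hj
    · intro j hj
      have := (mem_GG.1 (GG_inv hg)).2 j
      simp only [Finset.mem_filter, Finset.mem_univ, true_and] at hj ⊢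
      rw [this, hj]
    · intro j _; simp
    · intro j _; simp
    · intro j _; rfl
  rw [← nsmul_eq_mul, ← Finset.sum_const, ← Finset.sum_congr rfl h1, Finset.sum_comm,
    Finset.sum_congr rfl h2, Finset.sum_const, nsmul_eq_mul]

lemma SS_perm {n : ℕ} (w y : Fin n → ℝ) (a b : Fin n) (hab : a ≠ b) (hw : w a = w b)
    (π : Equiv.Perm (Fin n)) : SS n (fun j => w (π j)) y = SS n w y := by
  rcases Int.units_eq_one_or (Equiv.Perm.sign π) with h | h
  · exact SS_comp w y π h
  · rw [← SS_comp w y (Equiv.swap a b * π)]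
    · congr 1
      funext j
      rw [Equiv.Perm.mul_apply, Equiv.swap_apply_def]
      split_ifs with h1 h2
      · rw [h1, hw]
      · rw [h2, hw]
      · rfl
    · rw [Equiv.Perm.mem_alternatingGroup, Equiv.Perm.sign_mul, Equiv.Perm.sign_swap hab, h]
      rfl

lemma lower_one {n : ℕ} (hn : 5 ≤ n) (x y : Fin n → ℝ) (hx : ∑ j, x j = 0)
    (hx0 : ∑ j, |x j| ≠ 0) : ∃ h : ℕ, 0 < h ∧ h < n ∧
      ((1 / (n : ℝ)) * ∑ j, |x j|) * SS n (zvec n h) y ≤ SS n x y := by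
  classical
  set p : Fin n → Prop := fun j => 0 < x j with hp
  set I := Finset.univ.filter p with hI
  set J := Finset.univ.filter (fun j => ¬ p j) with hJ
  set P := ∑ j ∈ I, x j with hP
  have hcard : I.card + J.card = n := by
    simpa using Finset.card_filter_add_card_filter_not (s := (Finset.univ : Finset (Fin n))) p
  have hsum : P + ∑ j ∈ J, x j = 0 := by
    rw [← hx]; exact Finset.sum_filter_add_sum_filter_not _ p x
  have habs : ∑ j, |x j| = 2 * P := by
    rw [← Finset.sum_filter_add_sum_filter_not _ p]
    have e1 : ∑ j ∈ I, |x j| = P := Finset.sum_congr rfl fun j hj =>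
      abs_of_pos (by simpa [hI, hp] using hj)
    have e2 : ∑ j ∈ J, |x j| = - ∑ j ∈ J, x j := by
      rw [← Finset.sum_neg_distrib]
      exact Finset.sum_congr rfl fun j hj => abs_of_nonpos (by simpa [hJ, hp] using hj)
    change ∑ j ∈ I, |x j| + ∑ j ∈ J, |x j| = _
    rw [e1, e2]; linarith
  have hP0 : P ≠ 0 := by
    intro h; apply hx0; rw [habs, h, mul_zero]
  have hIpos : 0 < I.card := by
    rw [Finset.card_pos]; by_contra h
    rw [Finset.not_nonempty_iff_eq_empty] at h
    apply hP0; rw [hP, h, Finset.sum_empty]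
  have hJpos : 0 < J.card := by
    rw [Finset.card_pos]; by_contra h
    rw [Finset.not_nonempty_iff_eq_empty] at h
    apply hP0; rw [h, Finset.sum_empty] at hsum; linarith
  set h := I.card with hh
  have hhn : h < n := by omega
  refine ⟨h, hIpos, hhn, ?_⟩
  -- the permutation
  have hcardeq : Fintype.card {j // p j} = Fintype.card {j : Fin n // (j : ℕ) < h} := by
    rw [Fintype.card_fin_lt_of_le hhn.le, Fintype.card_subtype]
  let e : {j // p j} ≃ {j : Fin n // (j : ℕ) < h} := Fintype.equivOfCardEq hcardeq
  let π : Equiv.Perm (Fin n) := e.extendSubtype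
  have hπ1 : ∀ j, p j → ((π j : Fin n) : ℕ) < h := fun j hj => e.extendSubtype_mem j hj
  have hπ2 : ∀ j, ¬ p j → ¬ ((π j : Fin n) : ℕ) < h := fun j hj => e.extendSubtype_not_mem j hj
  obtain ⟨a, b, hab, -, -, -, -, hpab⟩ :=
    exists_pair hn (fun j => (j : ℕ) < h) ⟨0, by omega⟩ ⟨0, by omega⟩
  have hz : zvec n h a = zvec n h b := by simp only [zvec, hpab]
  rw [← SS_perm (zvec n h) y a b hab hz π]
  have hGpos : 0 < ((GG p).card : ℝ) := by
    rw [Nat.cast_pos, Finset.card_pos]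
    exact ⟨1, mem_GG.2 ⟨one_mem _, fun j => by simp⟩⟩
  have hn0 : (0 : ℝ) < n := by exact_mod_cast (by omega : 0 < n)
  have hI0 : (0 : ℝ) < h := by exact_mod_cast hIpos
  have hJ0 : (0 : ℝ) < J.card := by exact_mod_cast hJpos
  have hJc : (J.card : ℝ) = n - h := by
    have hq : (h : ℝ) + J.card = n := by exact_mod_cast hcard
    linarith
  have key : ∀ i, ((GG p).card : ℝ) * (((1 / (n : ℝ)) * ∑ j, |x j|) * zvec n h (π i)) =
      ∑ g ∈ GG p, x (g i) := by
    intro i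
    have := avg_GG hn p x i
    by_cases hi : p i
    · have hf : (Finset.univ.filter fun j => p j ↔ p i) = I := by simp [hI, hi]
      rw [hf, ← hh, ← hP] at this
      rw [habs, zvec, if_pos (hπ1 i hi)]
      field_simp
      linarith
    · have hf : (Finset.univ.filter fun j => p j ↔ p i) = J := by simp [hJ, hi]
      rw [hf, show ∑ j ∈ J, x j = - P by linarith] at this
      rw [habs, zvec, if_neg (hπ2 i hi), ← hJc]
      field_simp
      linarith
  have h2 : ((GG p).card : ℝ) * (((1 / (n : ℝ)) * ∑ j, |x j|) *
      SS n (fun j => zvec n h (π j)) y) ≤ ((GG p).card : ℝ) * SS n x y := by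
    rw [← SS_smul _ (by positivity), ← SS_smul _ hGpos.le]
    simp only [key]
    refine (SS_sum (GG p) (fun g j => x (g j)) y).trans (le_of_eq ?_)
    rw [Finset.sum_congr rfl (fun g hg => SS_comp x y g (mem_GG.1 hg).1), Finset.sum_const,
      nsmul_eq_mul]
  exact le_of_mul_le_mul_left h2 hGpos

lemma upper_SS {n : ℕ} (hn : 5 ≤ n) (x y : Fin n → ℝ) :
    (n : ℝ) * SS n x y ≤ ((n.factorial : ℝ) / 2) * ((∑ j, |x j|) * ∑ j, |y j|) := by
  classical
  have : Nontrivial (Fin n) := Fin.nontrivial_iff_two_le.2 (by omega)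
  have hG : (GG (fun _ : Fin n => True)).card = Fintype.card (alternatingGroup (Fin n)) := by
    rw [Fintype.card_subtype]
    simp [GG]
  have hc : (Fintype.card (alternatingGroup (Fin n)) : ℝ) = (n.factorial : ℝ) / 2 := by
    have h := two_mul_card_alternatingGroup (α := Fin n)
    rw [Fintype.card_perm, Fintype.card_fin] at h
    rw [← h]; push_cast; ring
  have hsum : ∀ j, (n : ℝ) * ∑ σ : alternatingGroup (Fin n), |x ((σ : Equiv.Perm (Fin n)) j)| =
      ((n.factorial : ℝ) / 2) * ∑ j, |x j| := by
    intro j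
    have := avg_GG hn (fun _ => True) (fun j => |x j|) j
    rw [hG, hc] at this
    simp only [Finset.filter_true, Finset.card_univ, Fintype.card_fin] at this
    rw [← this]
    congr 1
    exact (Finset.sum_subtype (GG fun _ : Fin n => True) (by intro σ; simp [mem_GG])
      (fun σ : Equiv.Perm (Fin n) => |x (σ j)|)).symm
  calc (n : ℝ) * SS n x y
      ≤ n * ∑ σ : alternatingGroup (Fin n), ∑ j, |x ((σ : Equiv.Perm (Fin n)) j)| * |y j| := by
        unfold SS
        gcongr with σ
        refine (Finset.abs_sum_le_sum_abs _ _).trans (le_of_eq ?_)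
        simp only [abs_mul]
    _ = ∑ j, (n * ∑ σ : alternatingGroup (Fin n), |x ((σ : Equiv.Perm (Fin n)) j)|) * |y j| := by
        rw [Finset.sum_comm, Finset.mul_sum]
        simp only [← Finset.sum_mul, mul_assoc]
    _ = _ := by
        simp only [hsum]
        rw [← Finset.mul_sum, mul_assoc]

/-- For `n ≥ 5` and `x, y ∈ Hₙ` one has
`cₙ·|x|₁·|y|₁ ≤ sₙ(x,y) ≤ |x|₁·|y|₁`. -/
theorem stmt_10 (n : ℕ) (hn : 5 ≤ n) (x y : Fin n → ℝ)
    (hx : ∑ j, x j = 0) (hy : ∑ j, y j = 0) :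
    cConst n * ((1 / (n : ℝ)) * ∑ j, |x j|) * ((1 / (n : ℝ)) * ∑ j, |y j|) ≤ snBil n x y ∧
    snBil n x y ≤ ((1 / (n : ℝ)) * ∑ j, |x j|) * ((1 / (n : ℝ)) * ∑ j, |y j|) := by
  have hn0 : (0 : ℝ) < n := by exact_mod_cast (by omega : 0 < n)
  have hf0 : (0 : ℝ) < n.factorial := by exact_mod_cast n.factorial_pos
  constructor
  · have hnn : 0 ≤ snBil n x y := by
      rw [snBil_eq]; exact mul_nonneg (by positivity) (SS_nonneg x y)
    by_cases hx0 : ∑ j, |x j| = 0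
    · simpa [hx0] using hnn
    by_cases hy0 : ∑ j, |y j| = 0
    · simpa [hy0] using hnn
    obtain ⟨h, h1, h2, h3⟩ := lower_one hn x y hx hx0
    obtain ⟨k, k1, k2, k3⟩ := lower_one hn y (zvec n h) hy hy0
    rw [SS_symm _ (zvec n h), SS_symm y] at k3
    have hc : cConst n ≤ snBil n (zvec n h) (zvec n k) := by
      apply csInf_le
      · refine ⟨0, ?_⟩
        rintro r ⟨h, k, -, -, -, -, rfl⟩
        rw [snBil_eq]; exact mul_nonneg (by positivity) (SS_nonneg _ _)
      · exact ⟨h, k, h1, h2, k1, k2, rfl⟩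
    set X := (1 / (n : ℝ)) * ∑ j, |x j| with hX
    set Y := (1 / (n : ℝ)) * ∑ j, |y j| with hY
    have hX0 : 0 ≤ X := by positivity
    have hY0 : 0 ≤ Y := by positivity
    calc cConst n * X * Y ≤ snBil n (zvec n h) (zvec n k) * X * Y := by gcongr
      _ = (2 / (n.factorial : ℝ)) * (1 / (n : ℝ)) * (X * (Y * SS n (zvec n h) (zvec n k))) := by
          rw [snBil_eq]; ring
      _ ≤ (2 / (n.factorial : ℝ)) * (1 / (n : ℝ)) * (X * SS n (zvec n h) y) := by gcongr
      _ ≤ (2 / (n.factorial : ℝ)) * (1 / (n : ℝ)) * SS n x y := by gcongr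
      _ = _ := (snBil_eq n x y).symm
  · rw [snBil_eq]
    calc (2 / (n.factorial : ℝ)) * (1 / (n : ℝ)) * SS n x y
        = (2 / (n.factorial : ℝ)) * (1 / (n : ℝ)) * (1 / (n : ℝ)) * (n * SS n x y) := by
          field_simp
      _ ≤ (2 / (n.factorial : ℝ)) * (1 / (n : ℝ)) * (1 / (n : ℝ)) *
          (((n.factorial : ℝ) / 2) * ((∑ j, |x j|) * ∑ j, |y j|)) := by
          exact mul_le_mul_of_nonneg_left (upper_SS hn x y) (by positivity)
      _ = _ := by field_simp
end

section
/- The sequence (c_n · √(πn/2))_n converges to 1 as n → ∞, where c_n is the constant defined in the context. -/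
open Real Filter Topology

/-- Hypergeometric probability of a two by two table. -/
noncomputable def tab (a b c d : ℕ) : ℝ :=
  ((a+b).factorial * (c+d).factorial * (a+c).factorial * (b+d).factorial : ℝ) /
    ((a+b+c+d).factorial * a.factorial * b.factorial * c.factorial * d.factorial)

def Good (t : ℝ) (H J K L : ℕ) : Prop :=
  ∃ a b c d : ℕ, a + b = H ∧ c + d = J ∧ a + c = K ∧ b + d = L ∧ t ≤ tab a b c d

lemma Good.mono {t s : ℝ} {H J K L : ℕ} (h : Good t H J K L) (hs : s ≤ t) : Good s H J K L := by
  obtain ⟨a, b, c, d, h1, h2, h3, h4, h5⟩ := h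
  exact ⟨a, b, c, d, h1, h2, h3, h4, hs.trans h5⟩

lemma Good.swap {t : ℝ} {H J K L : ℕ} (h : Good t H J K L) : Good t J H K L := by
  obtain ⟨a, b, c, d, h1, h2, h3, h4, h5⟩ := h
  refine ⟨c, d, a, b, h2, h1, by omega, by omega, h5.trans (le_of_eq ?_)⟩
  unfold tab
  rw [show c + d + a + b = a + b + c + d by ring, add_comm c a, add_comm d b]
  ring

lemma Good.transp {t : ℝ} {H J K L : ℕ} (h : Good t H J K L) : Good t K L H J := by
  obtain ⟨a, b, c, d, h1, h2, h3, h4, h5⟩ := h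
  refine ⟨a, c, b, d, h3, h4, h1, h2, h5.trans (le_of_eq ?_)⟩
  unfold tab
  rw [show a + c + b + d = a + b + c + d by ring]
  ring

lemma tab_step (a b c d : ℕ) :
    tab a b c (d+1) * ((a+b+1) * (d+1)) = tab a (b+1) c d * ((c+d+1) * (b+1)) := by
  unfold tab
  rw [show a + b + c + (d+1) = a+b+c+d+1 by ring, show a + (b+1) + c + d = a+b+c+d+1 by ring,
    show b + 1 + d = b + (d+1) by ring, show c + (d+1) = c + d + 1 by ring,
    show a + (b+1) = a + b + 1 by ring,
    Nat.factorial_succ (c+d), Nat.factorial_succ (a+b), Nat.factorial_succ d,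
    Nat.factorial_succ b]
  push_cast
  field_simp

lemma tab_nonneg (a b c d : ℕ) : 0 ≤ tab a b c d := by unfold tab; positivity

lemma step_aux {t : ℝ} (a b c d H J K L: ℕ) (h1 : a + b = H + 1) (h2 : c + d = J)
   (h3 : a + c = K) (h4 : b + d = L) (h5 : t ≤ tab a b c d)
   (h : (H+1) * (d+1) ≤ b * (J+2)) : Good (t * ((J+1)/(J+2))) H (J+1) K L := by
  obtain ⟨b, rfl⟩ : ∃ b', b = b' + 1 := ⟨b - 1, by
    rcases b with _ | b
    · simp at h
    · simp⟩
  refine ⟨a, b, c, d+1, by omega, by omega, h3, by omega, ?_⟩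
  have := tab_step a b c d
  have hh : a + b = H := by omega
  rw [← Nat.cast_add, ← Nat.cast_add, hh, h2] at this
  have hR : ((H:ℝ)+1) * (d+1) ≤ (b+1) * (J+2) := by exact_mod_cast h
  have e : tab a b c (d+1) = tab a (b+1) c d * ((J+1) * (b+1) / ((H+1)*(d+1))) := by
    field_simp
    linarith
  rw [e]
  have : ((J:ℝ)+1)/(J+2) ≤ (J+1) * (b+1) / ((H+1)*(d+1)) := by
    rw [div_le_div_iff₀ (by positivity) (by positivity)]
    have : (0:ℝ) ≤ J + 1 := by positivity
    nlinarith
  exact mul_le_mul h5 this (by positivity) (tab_nonneg _ _ _ _)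

lemma Good.step {t : ℝ} {H J K L : ℕ} (ht : 0 ≤ t) (h : Good t (H+1) J K L) :
    Good (t * ((J+1)/(J+2))) H (J+1) K L := by
  obtain ⟨a, b, c, d, h1, h2, h3, h4, h5⟩ := h
  by_cases hc : (H+1) * (d+1) ≤ b * (J+2)
  · exact step_aux a b c d H J K L h1 h2 h3 h4 h5 hc
  · have hc' : (H+1) * (c+1) ≤ a * (J+2) := by
      rw [← h1, ← h2] at hc ⊢
      nlinarith
    obtain ⟨a', b', c', d', g1, g2, g3, g4, g5⟩ :=
      step_aux b a d c H J L K (by omega) (by omega) h4 h3 (h5.trans (le_of_eq (by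
        unfold tab
        rw [add_comm b a, add_comm d c, show a + b + d + c = a + b + c + d by ring]
        ring))) hc'
    refine ⟨b', a', d', c', by omega, by omega, g4, g3, g5.trans (le_of_eq ?_)⟩
    unfold tab
    rw [add_comm b' a', add_comm d' c', show a' + b' + d' + c' = a' + b' + c' + d' by ring]
    ring

lemma Good.iter (i : ℕ) : ∀ {t : ℝ} {H J K L : ℕ}, 0 ≤ t → Good t (H+i) J K L →
    Good (t * ((J+1)/(J+i+1))) H (J+i) K L := by
  induction i with
  | zero =>
    intro t H J K L ht h
    refine h.mono (le_of_eq ?_)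
    simp only [Nat.cast_zero, add_zero]
    rw [div_self (by positivity), mul_one]
  | succ i ih =>
    intro t H J K L ht h
    have h1 := Good.step (H := H+i) ht h
    have h2 := ih (by positivity) h1
    rw [show J + 1 + i = J + (i+1) by ring] at h2
    refine h2.mono (le_of_eq ?_)
    push_cast
    field_simp
    ring

/-- Stirling lower bound for interior tables. -/
lemma log_fact_upper (η : ℝ) (hη : 0 < η) : ∃ R : ℕ, ∀ n : ℕ, R ≤ n →
    log n.factorial ≤ n * log n - n + log n / 2 + log (2 * π) / 2 + η := by
  have h := (Stirling.tendsto_stirlingSeq_sqrt_pi.log (by positivity)).eventually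
    (gt_mem_nhds (show log (√π) < log (√π) + η by linarith))
  obtain ⟨R, hR⟩ := eventually_atTop.1 h
  refine ⟨R + 1, fun n hn => ?_⟩
  have h1 := hR n (by omega)
  rw [Stirling.log_stirlingSeq_formula] at h1
  have hn0 : (0:ℝ) < n := by exact_mod_cast (by omega : 0 < n)
  rw [log_sqrt pi_pos.le, log_mul (by norm_num) hn0.ne', log_div hn0.ne' (exp_ne_zero _), log_exp] at h1
  rw [log_mul (by norm_num) pi_pos.ne']
  linarith

lemma kl_bound (a b c d : ℝ) (ha : 0 < a) (hb : 0 < b) (hc : 0 < c) (hd : 0 < d) :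
    a * log a + b * log b + c * log c + d * log d + (a+b+c+d) * log (a+b+c+d)
     - (a+b) * log (a+b) - (c+d) * log (c+d) - (a+c) * log (a+c) - (b+d) * log (b+d)
    ≤ (a*d-b*c)^2 * (a+b+c+d) / ((a+b)*(c+d)*(a+c)*(b+d)) := by
  have key : ∀ x h k N : ℝ, 0 < x → 0 < h → 0 < k → 0 < N →
      x * (log x + log N - log h - log k) ≤ x * (x * N / (h * k) - 1) := by
    intro x h k N hx hh hk hN
    apply mul_le_mul_of_nonneg_left _ hx.le
    rw [← log_mul hx.ne' hN.ne', sub_sub, ← log_mul hh.ne' hk.ne', ← log_div (by positivity) (by positivity)]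
    exact log_le_sub_one_of_pos (by positivity)
  have k1 := key a (a+b) (a+c) (a+b+c+d) ha (by positivity) (by positivity) (by positivity)
  have k2 := key b (a+b) (b+d) (a+b+c+d) hb (by positivity) (by positivity) (by positivity)
  have k3 := key c (c+d) (a+c) (a+b+c+d) hc (by positivity) (by positivity) (by positivity)
  have k4 := key d (c+d) (b+d) (a+b+c+d) hd (by positivity) (by positivity) (by positivity)
  have e : (a*d-b*c)^2 * (a+b+c+d) / ((a+b)*(c+d)*(a+c)*(b+d)) =
      a * (a * (a+b+c+d) / ((a+b) * (a+c)) - 1) + b * (b * (a+b+c+d) / ((a+b) * (b+d)) - 1)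
      + c * (c * (a+b+c+d) / ((c+d) * (a+c)) - 1) + d * (d * (a+b+c+d) / ((c+d) * (b+d)) - 1) := by
    field_simp
    ring
  rw [e]
  linarith

lemma amgm_tab (a b c d : ℝ) (ha : 0 < a) (hb : 0 < b) (hc : 0 < c) (hd : 0 < d) :
    16 * (a*b*c*d) ≤ (a+b)*(c+d)*(a+c)*(b+d) := by
  have f : ∀ x y : ℝ, 4 * (x*y) ≤ (x+y)^2 := fun x y => by nlinarith [sq_nonneg (x-y)]
  apply le_of_sq_le_sq _ (by positivity)
  calc (16 * (a*b*c*d))^2 = (4*(a*b))*(4*(c*d))*(4*(a*c))*(4*(b*d)) := by ring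
    _ ≤ (a+b)^2*(c+d)^2*(a+c)^2*(b+d)^2 := by
      gcongr <;> apply f
    _ = _ := by ring

lemma tab_lower (η : ℝ) (hη : 0 < η) : ∃ R : ℕ, ∀ a b c d : ℕ, R ≤ a → R ≤ b → R ≤ c → R ≤ d →
    exp (-5*η - ((a:ℝ)*d-b*c)^2 * (a+b+c+d) / ((a+b)*(c+d)*(a+c)*(b+d))) * √(8/(π*(a+b+c+d))) ≤ tab a b c d := by
  obtain ⟨R, hR⟩ := log_fact_upper η hη
  refine ⟨R + 1, fun a b c d ha hb hc hd => ?_⟩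
  have up : ∀ n : ℕ, R + 1 ≤ n → _ := fun n hn => hR n (by omega)
  have lo : ∀ n : ℕ, R + 1 ≤ n → _ := fun n hn => Stirling.le_log_factorial_stirling (n := n) (by omega)
  have ha0 : (0:ℝ) < a := by exact_mod_cast (by omega : 0 < a)
  have hb0 : (0:ℝ) < b := by exact_mod_cast (by omega : 0 < b)
  have hc0 : (0:ℝ) < c := by exact_mod_cast (by omega : 0 < c)
  have hd0 : (0:ℝ) < d := by exact_mod_cast (by omega : 0 < d)
  have u1 := up a ha
  have u2 := up b hb
  have u3 := up c hc
  have u4 := up d hd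
  have u5 := up (a+b+c+d) (by omega)
  have l1 := lo (a+b) (by omega)
  have l2 := lo (c+d) (by omega)
  have l3 := lo (a+c) (by omega)
  have l4 := lo (b+d) (by omega)
  push_cast at u5 l1 l2 l3 l4
  have kl := kl_bound a b c d ha0 hb0 hc0 hd0
  have am := log_le_log (by positivity) (amgm_tab a b c d ha0 hb0 hc0 hd0)
  rw [log_mul (by norm_num) (by positivity), log_mul (by positivity) (by positivity),
    log_mul (by positivity) (by positivity), log_mul (by positivity) (by positivity),
    log_mul (by positivity) (by positivity),
    log_mul (by positivity) (by positivity), log_mul (by positivity) (by positivity)] at am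
  have tpos : 0 < tab a b c d := by unfold tab; positivity
  rw [← log_le_log_iff (by positivity) tpos, log_mul (exp_ne_zero _) (by positivity), log_exp,
    log_sqrt (by positivity), log_div (by norm_num) (by positivity), log_mul (by positivity) (by positivity)]
  unfold tab
  have f : ∀ n : ℕ, ((n.factorial : ℝ)) ≠ 0 := fun n => by positivity
  rw [log_div (by positivity) (by positivity), log_mul (by positivity) (f _), log_mul (by positivity) (f _), 
    log_mul (f _) (f _), log_mul (by positivity) (f _), log_mul (by positivity) (f _),
    log_mul (by positivity) (f _), log_mul (f _) (f _)]
  have e8 : log 8 = 3 * log 2 := by rw [show (8:ℝ) = 2^3 by norm_num, log_pow]; norm_num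
  have e16 : log 16 = 4 * log 2 := by rw [show (16:ℝ) = 2^4 by norm_num, log_pow]; norm_num
  rw [e16] at am
  rw [log_mul (by norm_num) pi_pos.ne'] at *
  rw [e8]
  linarith

lemma tab_interior (q : ℕ) (hq : 0 < q) (η : ℝ) (hη : 0 < η) : ∃ N0 : ℕ, ∀ H J K L N : ℕ,
    H + J = N → K + L = N → N0 ≤ N → N ≤ q * H → N ≤ q * J → N ≤ q * K → N ≤ q * L →
    Good (exp (-6*η) * √(8/(π*N))) H J K L := by
  obtain ⟨R, hR⟩ := tab_lower η hη
  obtain ⟨M, hM⟩ := exists_nat_ge ((q:ℝ)^4/η)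
  refine ⟨(R+2)*q^2 + M + 1, fun H J K L N hN hN' hN0 h1 h2 h3 h4 => ?_⟩
  have hNpos : 0 < N := by omega
  have big : ∀ x y : ℕ, N ≤ q * x → N ≤ q * y → (R+2) * N ≤ x * y := by
    intro x y hx hy
    have hm : N * N ≤ (q*x) * (q*y) := Nat.mul_le_mul hx hy
    have hm2 : (R+2)*q^2 * N ≤ N * N := Nat.mul_le_mul_right _ (by omega)
    have : q^2 * ((R+2)*N) ≤ q^2 * (x*y) := by nlinarith
    exact Nat.le_of_mul_le_mul_left this (by positivity)
  obtain ⟨a, ha⟩ : ∃ a, a = H * K / N := ⟨_, rfl⟩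
  have ha1 : a * N ≤ H * K := by rw [ha]; exact Nat.div_mul_le_self _ _
  have ha2 : H * K < (a + 1) * N := by
    rw [ha, add_mul, one_mul]; exact Nat.lt_div_mul_add hNpos
  have B1 := big H K h1 h3
  have B2 := big H L h1 h4
  have B3 := big J K h2 h3
  have B4 := big J L h2 h4
  have aR : R < a := by
    by_contra hc
    have : (a+1) * N ≤ (R+2) * N := Nat.mul_le_mul_right _ (by omega)
    omega
  have bR : R + a ≤ H := by
    by_contra hc
    have : H * N < (R + a) * N := Nat.mul_lt_mul_of_pos_right (by omega) hNpos
    nlinarith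
  have cR : R + a ≤ K := by
    by_contra hc
    have : K * N < (R + a) * N := Nat.mul_lt_mul_of_pos_right (by omega) hNpos
    nlinarith
  have dR : R + H ≤ L + a := by
    by_contra hc
    have : (L + a + 1) * N ≤ (R + H) * N := Nat.mul_le_mul_right _ (by omega)
    nlinarith
  obtain ⟨b, rfl⟩ : ∃ b, H = a + b := ⟨H - a, by omega⟩
  obtain ⟨c, rfl⟩ : ∃ c, K = a + c := ⟨K - a, by omega⟩
  obtain ⟨d, rfl⟩ : ∃ d, L = b + d := ⟨L - b, by omega⟩
  obtain rfl : J = c + d := by omega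
  refine ⟨a, b, c, d, rfl, rfl, rfl, rfl, le_trans ?_ (hR a b c d (by omega) (by omega) (by omega) (by omega))⟩
  have eN : (N:ℝ) = a + b + c + d := by rw [← hN]; push_cast; ring
  rw [← eN]
  have hNr : (0:ℝ) < N := by exact_mod_cast hNpos
  apply mul_le_mul_of_nonneg_right _ (by positivity)
  apply exp_le_exp.2
  have r1 : (a:ℝ) * N ≤ (a+b) * (a+c) := by exact_mod_cast ha1
  have r2 : ((a:ℝ)+b) * (a+c) < (a+1) * N := by exact_mod_cast ha2
  have hΔ : ((a:ℝ)*d-b*c)^2 ≤ (N:ℝ)^2 := by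
    apply sq_le_sq'
    · rw [eN] at *; nlinarith
    · rw [eN] at *; nlinarith
  have hqr : (0:ℝ) < q := by exact_mod_cast hq
  have g1 : (N:ℝ)/q ≤ a + b := by rw [div_le_iff₀' hqr]; exact_mod_cast h1
  have g2 : (N:ℝ)/q ≤ c + d := by rw [div_le_iff₀' hqr]; exact_mod_cast h2
  have g3 : (N:ℝ)/q ≤ a + c := by rw [div_le_iff₀' hqr]; exact_mod_cast h3
  have g4 : (N:ℝ)/q ≤ b + d := by rw [div_le_iff₀' hqr]; exact_mod_cast h4
  have : ((a:ℝ)*d-b*c)^2 * N / ((a+b)*(c+d)*(a+c)*(b+d)) ≤ η := by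
    calc ((a:ℝ)*d-b*c)^2 * N / ((a+b)*(c+d)*(a+c)*(b+d))
        ≤ (N:ℝ)^2 * N / ((N:ℝ)/q * (N/q) * (N/q) * (N/q)) := by gcongr
      _ = (q:ℝ)^4/N := by field_simp
      _ ≤ η := by
        have hMN : (M:ℝ) ≤ N := by exact_mod_cast (by omega : M ≤ N)
        have := hM.trans hMN
        rw [div_le_iff₀ hη] at this
        rw [div_le_iff₀ hNr]; linarith
  linarith

lemma lift_good (q N K L : ℕ) (hq : 3 ≤ q) (hN : q ≤ N) (hN12 : 12 ≤ N) (t : ℝ) (ht : 0 ≤ t)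
    (X : ∀ H J : ℕ, H + J = N → N ≤ q * H → N ≤ q * J → Good t H J K L) (H J : ℕ) (hHJ : H + J = N) :
    Good (t * (1 - 2/q)) H J K L := by
  wlog hle : H ≤ J generalizing H J
  · exact (this J H (by omega) (by omega)).swap
  have hqr : (0:ℝ) < q := by exact_mod_cast (by omega : 0 < q)
  by_cases hc : N ≤ q * H
  · refine (X H J hHJ hc (hc.trans (Nat.mul_le_mul_left _ hle))).mono ?_
    apply mul_le_of_le_one_right ht
    have : (0:ℝ) ≤ 2/q := by positivity
    linarith
  · obtain ⟨m, hm⟩ : ∃ m, m = N / q + 1 := ⟨_, rfl⟩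
    have hm1 : N ≤ q * m := by
      rw [hm]; exact (Nat.lt_mul_div_succ N (by omega)).le
    have hm2 : q * m ≤ N + q := by
      rw [hm, mul_add, mul_one]; exact Nat.add_le_add_right (Nat.mul_div_le _ _) _
    have hm3 : 2 * m ≤ N := by
      have : N / q ≤ N / 3 := Nat.div_le_div_left hq (by norm_num)
      omega
    have hHm : H < m := by
      by_contra h
      exact hc (hm1.trans (Nat.mul_le_mul_left _ (by omega)))
    have := Good.iter (m - H) (H := H) (J := N - m) ht
      (by
        rw [show H + (m-H) = m by omega]
        exact X m (N-m) (by omega) hm1 (hm1.trans (Nat.mul_le_mul_left _ (by omega))))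
    rw [show N - m + (m - H) = J by omega] at this
    refine this.mono (mul_le_mul_of_nonneg_left ?_ ht)
    have e : (((N - m : ℕ):ℝ) + ((m - H : ℕ):ℝ)) = J := by
      exact_mod_cast (show N - m + (m - H) = J by omega)
    rw [e, le_div_iff₀ (by positivity), Nat.cast_sub (by omega)]
    have hJN : (J:ℝ) ≤ N := by exact_mod_cast (by omega : J ≤ N)
    have hm2r : (q:ℝ) * m ≤ N + q := by exact_mod_cast hm2
    have hqN : (q:ℝ) ≤ N := by exact_mod_cast hN
    have hq3 : (3:ℝ) ≤ q := by exact_mod_cast hq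
    have hm4 : (m:ℝ) ≤ N / q + 1 := by
      rw [← mul_le_mul_iff_right₀ hqr]; rw [mul_add, mul_div_cancel₀ _ hqr.ne']; linarith
    have h1 : 1 ≤ (N:ℝ)/q := by rwa [le_div_iff₀ hqr, one_mul]
    have h2 : 0 ≤ 1 - 2/(q:ℝ) := by
      rw [sub_nonneg, div_le_one hqr]; linarith
    calc (1 - 2/(q:ℝ)) * (J+1) ≤ (1 - 2/(q:ℝ)) * (N+1) := by gcongr
      _ = N + 1 - 2 * (N/q) - 2/q := by ring
      _ ≤ _ := by
        have : 0 ≤ 2/(q:ℝ) := by positivity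
        linarith

lemma good_uniform (ε : ℝ) (hε : 0 < ε) (hε1 : ε < 1) : ∃ N0 : ℕ, ∀ H J K L N : ℕ,
    H + J = N → K + L = N → N0 ≤ N → Good ((1-ε) * √(8/(π*N))) H J K L := by
  obtain ⟨q, hq⟩ := exists_nat_ge (8/ε)
  have hq8 : (8:ℝ) ≤ q := by
    refine le_trans ?_ hq
    rw [le_div_iff₀ hε]; linarith
  have hq8' : 8 ≤ q := by exact_mod_cast hq8
  have hqr : (0:ℝ) < q := by linarith
  obtain ⟨N0, hN0⟩ := tab_interior q (by omega) (ε/12) (by positivity)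
  refine ⟨N0 + q + 12, fun H J K L N h1 h2 h3 => ?_⟩
  have hq2 : 2/(q:ℝ) ≤ ε/4 := by
    rw [div_le_iff₀ hε] at hq
    rw [div_le_iff₀ hqr]; linarith
  have A : ∀ K L : ℕ, K + L = N → N ≤ q * K → N ≤ q * L → ∀ H J : ℕ, H + J = N →
      Good (exp (-6*(ε/12)) * √(8/(π*N)) * (1 - 2/q)) H J K L := by
    intro K L hKL hK hL H J hHJ
    refine lift_good q N K L (by omega) (by omega) (by omega) _ (by positivity) ?_ H J hHJ
    intro H J hHJ hH hJ
    exact hN0 H J K L N hHJ hKL (by omega) hH hJ hK hL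
  have h0 : 0 ≤ 1 - 2/(q:ℝ) := by linarith
  have B := lift_good q N H J (by omega) (by omega) (by omega) _
    (mul_nonneg (by positivity) h0) (fun K L hKL hK hL => (A K L hKL hK hL H J h1).transp) K L h2
  refine B.transp.mono ?_
  have e1 : 1 - ε/2 ≤ exp (-6*(ε/12)) := by
    have := add_one_le_exp (-6*(ε/12)); linarith
  have e2 : (1 - ε) ≤ exp (-6*(ε/12)) * (1 - 2/q) * (1 - 2/q) := by
    calc 1 - ε ≤ (1-ε/2) * (1-ε/4) * (1-ε/4) := by nlinarith [sq_nonneg ε, mul_pos hε hε, mul_nonneg (sq_nonneg ε) (sub_nonneg.2 hε1.le)]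
      _ ≤ _ := by
        have : 0 ≤ 1 - ε/4 := by linarith
        have : 1 - ε/4 ≤ 1 - 2/(q:ℝ) := by linarith
        gcongr
  calc (1-ε) * √(8/(π*N)) ≤ (exp (-6*(ε/12)) * (1 - 2/q) * (1 - 2/q)) * √(8/(π*N)) := by gcongr
    _ = _ := by ring

lemma sum_perm_powerset (n k : ℕ) (G : Finset (Fin n) → ℝ) (S0 : Finset (Fin n)) (hS : S0.card = k) :
    (n.choose k : ℝ) * ∑ σ : Equiv.Perm (Fin n), G (S0.map σ.toEmbedding) =
      n.factorial * ∑ S ∈ Finset.powersetCard k Finset.univ, G S := by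
  have h1 : ∀ S ∈ Finset.powersetCard k (Finset.univ : Finset (Fin n)),
      ∑ σ : Equiv.Perm (Fin n), G (S.map σ.toEmbedding) =
      ∑ σ : Equiv.Perm (Fin n), G (S0.map σ.toEmbedding) := by
    intro S hSm
    have hc := (Finset.mem_powersetCard.1 hSm).2
    have e : {x // x ∈ S0} ≃ {x // x ∈ S} := Fintype.equivOfCardEq (by simp [hc, hS])
    obtain ⟨τ, hτ⟩ : ∃ τ : Equiv.Perm (Fin n), S0.map τ.toEmbedding = S := by
      refine ⟨e.extendSubtype, ?_⟩
      apply Finset.eq_of_subset_of_card_le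
      · intro x hx
        obtain ⟨y, hy, rfl⟩ := Finset.mem_map.1 hx
        exact e.extendSubtype_mem y hy
      · simp [hc, hS]
    rw [← Equiv.sum_comp (Equiv.mulRight τ)
      (fun σ : Equiv.Perm (Fin n) => G (S0.map σ.toEmbedding))]
    apply Finset.sum_congr rfl
    intro σ _
    rw [← hτ, Finset.map_map]
    rfl
  have h2 : ∀ σ : Equiv.Perm (Fin n), ∑ S ∈ Finset.powersetCard k (Finset.univ : Finset (Fin n)),
      G (S.map σ.toEmbedding) = ∑ S ∈ Finset.powersetCard k Finset.univ, G S := by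
    intro σ
    conv_rhs => rw [show (Finset.univ : Finset (Fin n)) = Finset.univ.map σ.toEmbedding by simp,
      Finset.powersetCard_map, Finset.sum_map]
    rfl
  have h3 := Finset.sum_congr rfl h1
  rw [Finset.sum_comm, Finset.sum_congr rfl (fun σ _ => h2 σ)] at h3
  simp only [Finset.sum_const, Finset.card_powersetCard, Finset.card_univ, Fintype.card_perm,
    Fintype.card_fin, nsmul_eq_mul] at h3
  exact h3.symm

lemma card_inter_powerset (n k w : ℕ) (hw : w ≤ k) (A : Finset (Fin n)) :
    ((Finset.powersetCard k (Finset.univ : Finset (Fin n))).filter (fun S => (S ∩ A).card = w)).card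
      = A.card.choose w * (n - A.card).choose (k - w) := by
  have hA : (Aᶜ).card = n - A.card := by simp [Finset.card_compl]
  rw [← hA, ← Finset.card_powersetCard w A, ← Finset.card_powersetCard (k-w) (Aᶜ), ← Finset.card_product]
  refine Finset.card_bij' (fun S _ => (S ∩ A, S ∩ Aᶜ)) (fun p _ => p.1 ∪ p.2) ?_ ?_ ?_ ?_
  · intro S hS
    simp only [Finset.mem_filter, Finset.mem_powersetCard, Finset.subset_univ, true_and,
      Finset.mem_product, Finset.inter_subset_right] at hS ⊢
    refine ⟨hS.2, ?_⟩
    have : (S ∩ A).card + (S ∩ Aᶜ).card = S.card := by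
      rw [← Finset.sdiff_eq_inter_compl]; exact Finset.card_inter_add_card_sdiff S A
    omega
  · intro p hp
    simp only [Finset.mem_filter, Finset.mem_powersetCard, Finset.subset_univ, true_and,
      Finset.mem_product] at hp ⊢
    obtain ⟨⟨h1, h2⟩, h3, h4⟩ := hp
    have hd : Disjoint p.1 p.2 :=
      Finset.disjoint_of_subset_left h1 (Finset.disjoint_of_subset_right h3 disjoint_compl_right)
    have e : (p.1 ∪ p.2) ∩ A = p.1 := by
      ext x
      have := @h1 x
      have := @h3 x
      simp only [Finset.mem_compl, Finset.mem_inter, Finset.mem_union] at *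
      tauto
    rw [e, Finset.card_union_of_disjoint hd]
    omega
  · intro S hS
    ext x
    simp only [Finset.mem_compl, Finset.mem_inter, Finset.mem_union]
    tauto
  · intro p hp
    simp only [Finset.mem_powersetCard, Finset.mem_product] at hp
    obtain ⟨⟨h1, h2⟩, h3, h4⟩ := hp
    ext x
    · have := @h1 x
      have := @h3 x
      simp only [Finset.mem_compl, Finset.mem_inter, Finset.mem_union] at *
      tauto
    · have := @h1 x
      have := @h3 x
      simp only [Finset.mem_compl, Finset.mem_inter, Finset.mem_union] at *
      tauto

lemma sum_powerset_inter (n k : ℕ) (A : Finset (Fin n)) (F : ℕ → ℝ) :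
    ∑ S ∈ Finset.powersetCard k (Finset.univ : Finset (Fin n)), F ((S ∩ A).card) =
    ∑ w ∈ Finset.range (k+1), (A.card.choose w * (n - A.card).choose (k - w) : ℝ) * F w := by
  rw [← Finset.sum_fiberwise_of_maps_to (t := Finset.range (k+1)) (g := fun S => (S ∩ A).card)]
  · apply Finset.sum_congr rfl
    intro w hw
    rw [Finset.sum_congr rfl (g := fun _ => F w) (by
      intro S hS; rw [(Finset.mem_filter.1 hS).2])]
    rw [Finset.sum_const, card_inter_powerset n k w (by simpa [Nat.lt_succ_iff] using hw) A, nsmul_eq_mul]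
    push_cast; ring
  · intro S hS
    have := (Finset.mem_powersetCard.1 hS).2
    have h2 := Finset.card_le_card (Finset.inter_subset_left : S ∩ A ⊆ S)
    simp only [Finset.mem_range]; omega

lemma sum_alt (n : ℕ) (f : Equiv.Perm (Fin n) → ℝ) (τ : Equiv.Perm (Fin n))
    (hτ : Equiv.Perm.sign τ = -1) (hf : ∀ σ, f (σ * τ) = f σ) :
    2 * ∑ σ : alternatingGroup (Fin n), f (σ : Equiv.Perm (Fin n)) = ∑ σ, f σ := by
  rw [← Finset.sum_filter_add_sum_filter_not Finset.univ (fun σ => Equiv.Perm.sign σ = 1) f]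
  have h1 : ∑ σ : alternatingGroup (Fin n), f (σ : Equiv.Perm (Fin n)) =
      ∑ σ ∈ Finset.univ.filter (fun σ : Equiv.Perm (Fin n) => Equiv.Perm.sign σ = 1), f σ := by
    refine (Finset.sum_subtype _ ?_ f).symm
    intro σ
    simp [Equiv.Perm.mem_alternatingGroup]
  have h2 : ∑ σ ∈ Finset.univ.filter (fun σ : Equiv.Perm (Fin n) => ¬ Equiv.Perm.sign σ = 1), f σ =
      ∑ σ ∈ Finset.univ.filter (fun σ : Equiv.Perm (Fin n) => Equiv.Perm.sign σ = 1), f σ := by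
    symm
    refine Finset.sum_bij' (fun σ _ => σ * τ) (fun σ _ => σ * τ⁻¹) ?_ ?_ ?_ ?_ ?_
    · intro σ hσ
      simp only [Finset.mem_filter, Finset.mem_univ, true_and] at hσ ⊢
      rw [Equiv.Perm.sign_mul, hσ, hτ]; decide
    · intro σ hσ
      simp only [Finset.mem_filter, Finset.mem_univ, true_and] at hσ ⊢
      rw [Equiv.Perm.sign_mul, Equiv.Perm.sign_inv, hτ, (Int.units_eq_one_or _).resolve_left hσ]; decide
    · intro σ hσ; simp
    · intro σ hσ; simp
    · intro σ hσ; exact (hf σ).symm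
  rw [h1, h2]; ring

lemma telescope (M m : ℕ) (hm : m ≤ M) (f Q : ℕ → ℝ) (c : ℝ)
    (hf : ∀ w, w < M → f w = c * (Q w - Q (w+1))) (h0 : Q 0 = 0) (hM : Q M = 0) :
    2 * (c * Q m) ≤ ∑ w ∈ Finset.range M, |f w| ∧
    ((∀ w, w < m → f w ≤ 0) → (∀ w, m ≤ w → w < M → 0 ≤ f w) →
      ∑ w ∈ Finset.range M, |f w| = 2 * (c * Q m)) := by
  have s1 : ∑ w ∈ Finset.range m, f w = c * (0 - Q m) := by
    rw [Finset.sum_congr rfl (fun w hw => hf w (by have := Finset.mem_range.1 hw; omega)),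
      ← Finset.mul_sum, Finset.sum_range_sub', h0]
  have sM : ∑ w ∈ Finset.range M, f w = 0 := by
    rw [Finset.sum_congr rfl (fun w hw => hf w (Finset.mem_range.1 hw)),
      ← Finset.mul_sum, Finset.sum_range_sub', h0, hM]; ring
  have split : ∀ g : ℕ → ℝ, ∑ w ∈ Finset.range M, g w =
      ∑ w ∈ Finset.range m, g w + ∑ w ∈ Finset.Ico m M, g w :=
    fun g => (Finset.sum_range_add_sum_Ico g hm).symm
  have s2 := split f
  rw [sM, s1] at s2
  rw [split]
  constructor
  · have a1 : -∑ w ∈ Finset.range m, f w ≤ ∑ w ∈ Finset.range m, |f w| := by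
      rw [← Finset.sum_neg_distrib]; exact Finset.sum_le_sum (fun w _ => neg_le_abs _)
    have a2 : ∑ w ∈ Finset.Ico m M, f w ≤ ∑ w ∈ Finset.Ico m M, |f w| :=
      Finset.sum_le_sum (fun w _ => le_abs_self _)
    linarith
  · intro n1 n2
    have a1 : ∑ w ∈ Finset.range m, |f w| = -∑ w ∈ Finset.range m, f w := by
      rw [← Finset.sum_neg_distrib]
      exact Finset.sum_congr rfl (fun w hw => abs_of_nonpos (n1 w (Finset.mem_range.1 hw)))
    have a2 : ∑ w ∈ Finset.Ico m M, |f w| = ∑ w ∈ Finset.Ico m M, f w :=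
      Finset.sum_congr rfl (fun w hw => abs_of_nonneg
        (n2 w (Finset.mem_Ico.1 hw).1 (Finset.mem_Ico.1 hw).2))
    linarith

/-- auxiliary telescoping function -/
noncomputable def Qf (H J K : ℕ) : ℕ → ℝ
  | 0 => 0
  | (v+1) => if v ≤ K then (H.choose v * J.choose (K - v) : ℝ) else 0

lemma Qf_tel (H J K w : ℕ) (hw : w < K + 2) :
    (((H:ℝ)+J+2) * w - (H+1)*(K+1)) * ((H+1).choose w * (J+1).choose (K+1-w) : ℝ) =
      ((H+1)*(J+1)) * (Qf H J K w - Qf H J K (w+1)) := by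
  have E : ∀ n k : ℕ, ((n:ℝ)+1) * n.choose k = (n+1).choose (k+1) * (k+1) := by
    intro n k; exact_mod_cast Nat.add_one_mul_choose_eq n k
  have P : ∀ n k : ℕ, ((n+1).choose (k+1) : ℝ) = n.choose k + n.choose (k+1) := by
    intro n k; exact_mod_cast Nat.choose_succ_succ n k
  rcases w with _ | v
  · simp only [Qf, Nat.zero_le, if_true, Nat.choose_zero_right, Nat.sub_zero, Nat.cast_zero, Nat.cast_one]
    have := E J K
    linear_combination ((H:ℝ)+1) * this
  · by_cases hv : v = K
    · subst hv
      simp only [Qf, le_refl, if_true, Nat.sub_self, Nat.choose_zero_right]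
      rw [if_neg (by omega)]
      have := E H v
      push_cast
      linear_combination (-((J:ℝ)+1)) * this
    · obtain ⟨u, rfl⟩ : ∃ u, K = v + u + 1 := ⟨K - v - 1, by omega⟩
      simp only [Qf]
      rw [if_pos (by omega), if_pos (by omega), show v+u+1+1-(v+1) = u+1 by omega,
        show v+u+1-v = u+1 by omega, show v+u+1-(v+1) = u by omega]
      have e1 := E H v
      have e2 := E J u
      have p1 := P H v
      have p2 := P J u
      have x1 : ((H:ℝ)+1) * H.choose (v+1) = (H - v) * (H+1).choose (v+1) := by
        linear_combination (-((H:ℝ)+1)) * p1 - e1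
      have x2 : ((J:ℝ)+1) * J.choose (u+1) = (J - u) * (J+1).choose (u+1) := by
        linear_combination (-((J:ℝ)+1)) * p2 - e2
      have y1 : ((H:ℝ)+1)*(J+1) * (H.choose v * J.choose (u+1)) =
         (v+1) * (J-u) * ((H+1).choose (v+1) * (J+1).choose (u+1)) := by
        calc _ = (((H:ℝ)+1) * H.choose v) * (((J:ℝ)+1) * J.choose (u+1)) := by ring
          _ = _ := by rw [e1, x2]; ring
      have y2 : ((H:ℝ)+1)*(J+1) * (H.choose (v+1) * J.choose u) =
         (u+1) * (H-v) * ((H+1).choose (v+1) * (J+1).choose (u+1)) := by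
        calc _ = (((H:ℝ)+1) * H.choose (v+1)) * (((J:ℝ)+1) * J.choose u) := by ring
          _ = _ := by rw [e2, x1]; ring
      push_cast
      linear_combination y2 - y1

lemma card_lt_filter (n h : ℕ) (hh : h ≤ n) :
    ((Finset.univ : Finset (Fin n)).filter (fun j : Fin n => (j:ℕ) < h)).card = h := by
  rw [Fin.card_filter_val_lt]; omega

lemma zvec_eq (n h : ℕ) (h0 : 0 < h) (hn : h < n) (j : Fin n) :
    zvec n h j = (n:ℝ)^2/(2*h*(n-h)) * ((if (j:ℕ) < h then 1 else 0) - (h:ℝ)/n) := by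
  have h0r : (0:ℝ) < h := by exact_mod_cast h0
  have hnr : (0:ℝ) < n := by exact_mod_cast (by omega : 0 < n)
  have hd : (0:ℝ) < (n:ℝ) - h := by rw [sub_pos]; exact_mod_cast hn
  unfold zvec
  split_ifs
  · field_simp
  · field_simp
    ring

lemma inner_zvec (n h k : ℕ) (h0 : 0 < h) (hn : h < n) (k0 : 0 < k) (kn : k < n)
    (σ : Equiv.Perm (Fin n)) :
    ∑ j, zvec n h (σ j) * zvec n k j = (n:ℝ)^2/(2*h*(n-h)) * ((n:ℝ)^2/(2*k*(n-k))) *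
      (((((Finset.univ.filter (fun j : Fin n => (j:ℕ) < k)).map σ.toEmbedding) ∩
        Finset.univ.filter (fun j : Fin n => (j:ℕ) < h)).card : ℝ) - h * k / n) := by
  have hnr : (0:ℝ) < n := by exact_mod_cast (by omega : 0 < n)
  have c1 : ∑ j : Fin n, (if (j:ℕ) < k then (1:ℝ) else 0) = k := by
    rw [Finset.sum_boole, card_lt_filter n k kn.le]
  have c2 : ∑ j : Fin n, (if ((σ j : Fin n):ℕ) < h then (1:ℝ) else 0) = h := by
    rw [Equiv.sum_comp σ (fun j : Fin n => if (j:ℕ) < h then (1:ℝ) else 0),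
      Finset.sum_boole, card_lt_filter n h hn.le]
  have c3 : ∑ j : Fin n, (if ((σ j : Fin n):ℕ) < h then (1:ℝ) else 0) * (if (j:ℕ) < k then (1:ℝ) else 0)
      = ((((Finset.univ.filter (fun j : Fin n => (j:ℕ) < k)).map σ.toEmbedding) ∩
        Finset.univ.filter (fun j : Fin n => (j:ℕ) < h)).card : ℝ) := by
    rw [Finset.inter_filter, Finset.inter_univ, Finset.filter_map, Finset.card_map, Finset.filter_filter,
      ← Finset.sum_boole]
    apply Finset.sum_congr rfl
    intro j _
    simp only [Function.comp, Equiv.coe_toEmbedding]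
    by_cases a : (j:ℕ) < k <;> by_cases b : ((σ j : Fin n):ℕ) < h <;> simp [a, b]
  rw [← c3]
  have e : ∀ j : Fin n, zvec n h (σ j) * zvec n k j =
      (n:ℝ)^2/(2*h*(n-h)) * ((n:ℝ)^2/(2*k*(n-k))) *
      ((if ((σ j : Fin n):ℕ) < h then (1:ℝ) else 0) * (if (j:ℕ) < k then (1:ℝ) else 0)
       - (k/n) * (if ((σ j : Fin n):ℕ) < h then (1:ℝ) else 0)
       - (h/n) * (if (j:ℕ) < k then (1:ℝ) else 0) + (h/n) * (k/n)) := by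
    intro j
    rw [zvec_eq n h h0 hn, zvec_eq n k k0 kn]; ring
  rw [Finset.sum_congr rfl (fun j _ => e j), ← Finset.mul_sum, Finset.sum_add_distrib,
    Finset.sum_sub_distrib, Finset.sum_sub_distrib, ← Finset.mul_sum, ← Finset.mul_sum, c1, c2]
  congr 1
  simp only [Finset.sum_const, Finset.card_univ, Fintype.card_fin, nsmul_eq_mul]
  field_simp
  ring

lemma exists_odd_fix (n k : ℕ) (hn : 3 ≤ n) (kn : k < n) :
    ∃ τ : Equiv.Perm (Fin n), Equiv.Perm.sign τ = -1 ∧ (∀ j, τ (τ j) = j) ∧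
      ∀ j, zvec n k (τ j) = zvec n k j := by
  have main : ∀ a b : Fin n, a ≠ b → zvec n k a = zvec n k b →
      ∃ τ : Equiv.Perm (Fin n), Equiv.Perm.sign τ = -1 ∧ (∀ j, τ (τ j) = j) ∧
      ∀ j, zvec n k (τ j) = zvec n k j := by
    intro a b hab hz
    refine ⟨Equiv.swap a b, Equiv.Perm.sign_swap hab, fun j => Equiv.swap_apply_self _ _ _, fun j => ?_⟩
    rcases eq_or_ne j a with rfl | h1
    · rw [Equiv.swap_apply_left, hz]
    rcases eq_or_ne j b with rfl | h2
    · rw [Equiv.swap_apply_right, hz]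
    rw [Equiv.swap_apply_of_ne_of_ne h1 h2]
  by_cases hk : 2 ≤ k
  · refine main ⟨0, by omega⟩ ⟨1, by omega⟩ (by simp) ?_
    unfold zvec
    rw [if_pos (by simp; omega), if_pos (by simp; omega)]
  · refine main ⟨n-1, by omega⟩ ⟨n-2, by omega⟩ (by simp; omega) ?_
    unfold zvec
    rw [if_neg (by simp; omega), if_neg (by simp; omega)]

lemma snBil_eq_s11 (n h k : ℕ) (hn3 : 3 ≤ n) (h0 : 0 < h) (hn : h < n) (k0 : 0 < k) (kn : k < n) :
    snBil n (zvec n h) (zvec n k) = (n:ℝ)^2/(4*h*(n-h)*k*(n-k)) / n.choose k *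
      ∑ w ∈ Finset.range (k+1), |((n:ℝ) * w - h * k) * (h.choose w * (n-h).choose (k-w) : ℝ)| := by
  obtain ⟨τ, hτ, hττ, hτz⟩ := exists_odd_fix n k hn3 kn
  have h0r : (0:ℝ) < h := by exact_mod_cast h0
  have k0r : (0:ℝ) < k := by exact_mod_cast k0
  have hnr : (0:ℝ) < n := by exact_mod_cast (by omega : 0 < n)
  have hd : (0:ℝ) < (n:ℝ) - h := by rw [sub_pos]; exact_mod_cast hn
  have kd : (0:ℝ) < (n:ℝ) - k := by rw [sub_pos]; exact_mod_cast kn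
  have hcp : (0:ℝ) < n.choose k := by exact_mod_cast Nat.choose_pos kn.le
  have alt := sum_alt n (fun σ => |(1 / (n : ℝ)) * ∑ j, zvec n h (σ j) * zvec n k j|) τ hτ (by
    intro σ
    show |_| = |_|
    congr 2
    rw [← Equiv.sum_comp τ]
    apply Finset.sum_congr rfl
    intro j _
    rw [Equiv.Perm.mul_apply, hττ, hτz])
  unfold snBil
  rw [div_mul_eq_mul_div, alt]
  have step : ∀ σ : Equiv.Perm (Fin n), |(1 / (n : ℝ)) * ∑ j, zvec n h (σ j) * zvec n k j| =
      (fun S : Finset (Fin n) => (fun w : ℕ => (n:ℝ)^2/(4*h*(n-h)*k*(n-k)) * |(n:ℝ) * w - h * k|)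
        ((S ∩ Finset.univ.filter (fun j : Fin n => (j:ℕ) < h)).card))
      ((Finset.univ.filter (fun j : Fin n => (j:ℕ) < k)).map σ.toEmbedding) := by
    intro σ
    rw [inner_zvec n h k h0 hn k0 kn]
    simp only
    rw [← abs_of_pos (show 0 < (n:ℝ)^2/(4*h*(n-h)*k*(n-k)) by positivity), ← abs_mul]
    congr 1
    field_simp
    ring
  rw [Finset.sum_congr rfl (fun σ _ => step σ)]
  have sp := sum_perm_powerset n k (fun S : Finset (Fin n) => (fun w : ℕ => (n:ℝ)^2/(4*h*(n-h)*k*(n-k)) * |(n:ℝ) * w - h * k|)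
        ((S ∩ Finset.univ.filter (fun j : Fin n => (j:ℕ) < h)).card))
        (Finset.univ.filter (fun j : Fin n => (j:ℕ) < k)) (card_lt_filter n k kn.le)
  rw [sum_powerset_inter n k _ (fun w : ℕ => (n:ℝ)^2/(4*h*(n-h)*k*(n-k)) * |(n:ℝ) * w - h * k|),
    card_lt_filter n h hn.le] at sp
  have hf : (0:ℝ) < n.factorial := by positivity
  rw [div_eq_iff hf.ne', ← mul_right_inj' hcp.ne', sp, Finset.mul_sum, Finset.mul_sum, Finset.sum_mul,
    Finset.mul_sum]
  apply Finset.sum_congr rfl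
  intro w _
  rw [abs_mul, abs_of_nonneg (show (0:ℝ) ≤ h.choose w * (n-h).choose (k-w) by positivity)]
  field_simp

lemma choose_two_step (N K : ℕ) (hK : K ≤ N) :
    ((N+2).choose (K+1) : ℝ) * ((K+1) * (N+1-K)) = N.choose K * ((N+2)*(N+1)) := by
  have e1 : ((N:ℝ)+1+1) * (N+1).choose K = (N+1+1).choose (K+1) * (K+1) := by
    exact_mod_cast Nat.add_one_mul_choose_eq (N+1) K
  have e2 : (N.choose K : ℝ) * (N+1) = (N+1).choose K * (N+1-K) := by
    have := Nat.choose_mul_succ_eq N K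
    have h2 : ((N+1-K:ℕ):ℝ) = N+1-K := by rw [Nat.cast_sub (by omega)]; push_cast; ring
    rw [← h2]; exact_mod_cast this
  have e1' : ((N:ℝ)+1+1) * (N+1).choose K = (N+2).choose (K+1) * (K+1) := e1
  linear_combination (-((N:ℝ)+1-K)) * e1' - ((N:ℝ)+2) * e2

lemma snBil_mode (H J K : ℕ) (hN : 1 ≤ H + J) (hK : K ≤ H + J) :
    (∀ v ≤ K, ((H:ℝ)+J+2)/(2*(H+J+1)) * (H.choose v * J.choose (K-v) / (H+J).choose K) ≤
      snBil (H+J+2) (zvec (H+J+2) (H+1)) (zvec (H+J+2) (K+1))) ∧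
    (∃ v ≤ K, snBil (H+J+2) (zvec (H+J+2) (H+1)) (zvec (H+J+2) (K+1)) =
      ((H:ℝ)+J+2)/(2*(H+J+1)) * (H.choose v * J.choose (K-v) / (H+J).choose K)) := by
  have key := snBil_eq_s11 (H+J+2) (H+1) (K+1) (by omega) (by omega) (by omega) (by omega) (by omega)
  rw [show H + J + 2 - (H+1) = J + 1 by omega, show K + 1 + 1 = K + 2 by ring] at key
  push_cast at key
  have tel := fun m hm => telescope (K+2) m hm
    (fun w => (((H:ℝ)+J+2) * w - (H+1)*(K+1)) * ((H+1).choose w * (J+1).choose (K+1-w) : ℝ))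
    (Qf H J K) ((H+1)*(J+1)) (fun w hw => Qf_tel H J K w hw) rfl (by simp [Qf])
  have c2 := choose_two_step (H+J) K hK
  push_cast at c2
  have hKr : (K:ℝ) ≤ H + J := by exact_mod_cast hK
  have hd1 : (0:ℝ) < H + J + 1 - K := by linarith
  have p1 : (0:ℝ) < (H+J+2).choose (K+1) := by exact_mod_cast Nat.choose_pos (by omega)
  have p2 : (0:ℝ) < (H+J).choose K := by exact_mod_cast Nat.choose_pos (by omega)
  have hd2 : (0:ℝ) < (H:ℝ) + J + 2 - (H+1) := by have : (0:ℝ) ≤ J := by positivity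
                                                 linarith
  have hd3 : (0:ℝ) < (H:ℝ) + J + 2 - (K+1) := by linarith
  have coef : ∀ x : ℝ, ((H:ℝ)+J+2)^2/(4*(H+1)*(H+J+2-(H+1))*(K+1)*(H+J+2-(K+1))) / (H+J+2).choose (K+1)
      * (2 * ((H+1)*(J+1) * x)) = ((H:ℝ)+J+2)/(2*(H+J+1)) * (x / (H+J).choose K) := by
    intro x
    have e : ((H+J+2).choose (K+1) : ℝ) = (H+J).choose K * ((H+J+2)*(H+J+1)) / ((K+1) * (H+J+1-K)) := by
      rw [eq_div_iff (by positivity)]; exact c2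
    rw [e, show (H:ℝ)+J+2-(H+1) = J+1 by ring, show (H:ℝ)+J+2-(K+1) = H+J+1-K by ring]
    field_simp
    ring
  have cpos : 0 ≤ ((H:ℝ)+J+2)^2/(4*(H+1)*(H+J+2-(H+1))*(K+1)*(H+J+2-(K+1))) / (H+J+2).choose (K+1) := by
    positivity
  rw [key]
  constructor
  · intro v hv
    rw [← coef]
    have := (tel (v+1) (by omega)).1
    simp only [Qf, if_pos hv] at this
    exact mul_le_mul_of_nonneg_left this cpos
  · refine ⟨(H+1)*(K+1)/(H+J+2), ?_, ?_⟩
    · have : (H+1)*(K+1)/(H+J+2) < K+1 := by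
        rw [Nat.div_lt_iff_lt_mul (by omega)]
        nlinarith
      omega
    · have hv : (H+1)*(K+1)/(H+J+2) ≤ K := by
        have : (H+1)*(K+1)/(H+J+2) < K+1 := by
          rw [Nat.div_lt_iff_lt_mul (by omega)]
          nlinarith
        omega
      have h1 : (H+1)*(K+1)/(H+J+2) * (H+J+2) ≤ (H+1)*(K+1) := Nat.div_mul_le_self _ _
      have h2 : (H+1)*(K+1) < ((H+1)*(K+1)/(H+J+2)+1) * (H+J+2) := by
        have := Nat.lt_div_mul_add (a := (H+1)*(K+1)) (show 0 < H+J+2 by omega)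
        calc _ < _ := this
          _ = _ := by ring
      generalize (H+1)*(K+1)/(H+J+2) = v at hv h1 h2
      rw [← coef]
      have := (tel (v+1) (by omega)).2 ?_ ?_
      · simp only [Qf, if_pos hv] at this
        rw [this]
      · intro w hw
        apply mul_nonpos_of_nonpos_of_nonneg _ (by positivity)
        have : w * (H+J+2) ≤ v * (H+J+2) := Nat.mul_le_mul_right _ (by omega)
        have h3 : w * (H+J+2) ≤ (H+1)*(K+1) := this.trans h1
        have h4 : (w:ℝ) * (H+J+2) ≤ (H+1)*(K+1) := by exact_mod_cast h3
        linarith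
      · intro w hw _
        apply mul_nonneg _ (by positivity)
        have : (v+1) * (H+J+2) ≤ w * (H+J+2) := Nat.mul_le_mul_right _ (by omega)
        have h3 : (H+1)*(K+1) ≤ w * (H+J+2) := h2.le.trans this
        have h4 : ((H:ℝ)+1)*(K+1) ≤ w * (H+J+2) := by exact_mod_cast h3
        linarith

lemma choose_fact (a b : ℕ) : ((a+b).choose a : ℝ) = (a+b).factorial / (a.factorial * b.factorial) := by
  have := Nat.choose_mul_factorial_mul_factorial (Nat.le_add_right a b)
  rw [Nat.add_sub_cancel_left] at this
  rw [eq_div_iff (by positivity)]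
  rw [← this]; push_cast; ring

lemma tab_choose (a b c d : ℕ) :
    tab a b c d = (a+b).choose a * (c+d).choose c / (a+b+c+d).choose (a+c) := by
  have e := choose_fact (a+c) (b+d)
  rw [show a + c + (b + d) = a + b + c + d by ring] at e
  rw [e, choose_fact, choose_fact]
  unfold tab
  field_simp

lemma lower_bound (ε : ℝ) (hε : 0 < ε) (hε1 : ε < 1) :
    ∀ᶠ n : ℕ in atTop, 1 - ε ≤ cConst n * √(π * n / 2) := by
  obtain ⟨N0, hN0⟩ := good_uniform ε hε hε1
  filter_upwards [eventually_ge_atTop (N0 + 3)] with n hn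
  have hnr : (0:ℝ) < n := by exact_mod_cast (by omega : 0 < n)
  have hs : 0 < √(π * n / 2) := by positivity
  rw [← div_le_iff₀ hs]
  unfold cConst
  apply le_csInf
  · exact ⟨_, 1, 1, by omega, by omega, by omega, by omega, rfl⟩
  · rintro r ⟨h, k, h0, h1, k0, k1, rfl⟩
    obtain ⟨H, rfl⟩ : ∃ H, h = H + 1 := ⟨h - 1, by omega⟩
    obtain ⟨K, rfl⟩ : ∃ K, k = K + 1 := ⟨k - 1, by omega⟩
    obtain ⟨J, rfl⟩ : ∃ J, n = H + J + 2 := ⟨n - H - 2, by omega⟩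
    obtain ⟨L, hL⟩ : ∃ L, K + L = H + J := ⟨H + J - K, by omega⟩
    obtain ⟨a, b, c, d, e1, e2, e3, e4, e5⟩ := hN0 H J K L (H+J) rfl hL (by omega)
    have m := (snBil_mode H J K (by omega) (by omega)).1 a (by omega)
    rw [tab_choose, show a + b + c + d = H + J by omega, e1, e2, e3, show c = K - a by omega] at e5
    refine le_trans ?_ m
    rw [div_le_iff₀ hs]
    push_cast at e5 ⊢
    have hNr : (0:ℝ) < (H:ℝ) + J := by exact_mod_cast (by omega : 0 < H + J)
    have q1 : 1/2 ≤ ((H:ℝ)+J+2)/(2*(H+J+1)) := by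
      rw [div_le_div_iff₀ (by norm_num) (by positivity)]; linarith
    have q2 : 2 ≤ √(8/(π*((H:ℝ)+J))) * √(π * (H+J+2)/2) := by
      rw [← sqrt_mul (by positivity)]
      apply le_sqrt_of_sq_le
      have : 8/(π*((H:ℝ)+J)) * (π * (H+J+2)/2) = 4 * ((H+J+2)/(H+J)) := by
        field_simp
        norm_num
      rw [this]
      have : 1 ≤ ((H:ℝ)+J+2)/(H+J) := by rw [le_div_iff₀ hNr]; linarith
      linarith
    have h1e : 0 ≤ 1 - ε := by linarith
    calc 1 - ε = 1/2 * ((1-ε) * 2) := by ring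
      _ ≤ 1/2 * ((1-ε) * (√(8/(π*((H:ℝ)+J))) * √(π * (H+J+2)/2))) := by gcongr
      _ = 1/2 * ((1-ε) * √(8/(π*((H:ℝ)+J)))) * √(π * (H+J+2)/2) := by ring
      _ ≤ _ := by gcongr

/-- normalised central binomial coefficient -/
noncomputable def tc (j : ℕ) : ℝ := j.centralBinom / 4^j

lemma choose_half (m : ℕ) : (m.choose (m/2) : ℝ) = 2^m * tc ((m+1)/2) := by
  unfold tc
  rcases Nat.even_or_odd' m with ⟨j, rfl | rfl⟩
  · rw [show 2*j/2 = j by omega, show (2*j+1)/2 = j by omega, Nat.centralBinom_eq_two_mul_choose,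
      pow_mul]
    norm_num
    field_simp
  · rw [show (2*j+1)/2 = j by omega, show (2*j+1+1)/2 = j+1 by omega,
      Nat.centralBinom_eq_two_mul_choose]
    have : (2*(j+1)).choose (j+1) = 2 * (2*j+1).choose j := by
      rw [show 2*(j+1) = 2*j+1+1 by ring, Nat.choose_succ_succ, Nat.choose_symm_half]; ring
    rw [this]
    push_cast
    rw [show (4:ℝ)^(j+1) = 2 * 2^(2*j+1) by rw [show (4:ℝ) = 2^2 by norm_num, ← pow_mul]; ring]
    field_simp

lemma tc_tendsto : Tendsto (fun j : ℕ => tc j * √j) atTop (𝓝 (1/√π)) := by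
  have h := Stirling.tendsto_stirlingSeq_sqrt_pi
  have h2 : Tendsto (fun j : ℕ => Stirling.stirlingSeq (2*j)) atTop (𝓝 (√π)) :=
    h.comp (tendsto_id.const_mul_atTop' two_pos)
  have h3 := h2.div (h.pow 2) (by positivity)
  rw [show √π / √π^2 = 1/√π by field_simp] at h3
  refine h3.congr' ?_
  filter_upwards [eventually_ge_atTop 1] with j hj
  have hjr : (0:ℝ) < j := by exact_mod_cast hj
  have e := choose_fact j j
  rw [← two_mul] at e
  simp only [Pi.div_apply, Pi.pow_apply]
  unfold tc
  rw [Nat.centralBinom_eq_two_mul_choose, e]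
  simp only [Stirling.stirlingSeq]
  have s1 : √(2 * ((2*j:ℕ):ℝ)) = 2 * √j := by
    push_cast
    rw [show (2:ℝ) * (2*j) = 2^2 * j by ring, sqrt_mul (by norm_num), sqrt_sq (by norm_num)]
  have s2 : √(2 * (j:ℝ))^2 = 2 * j := sq_sqrt (by positivity)
  have s3 : √(j:ℝ) * √j = j := mul_self_sqrt hjr.le
  rw [s1, div_pow (_ : ℝ) (√(2 * (j:ℝ)) * _), mul_pow, s2]
  have p4 : (4:ℝ)^j = 2^(2*j) := by rw [pow_mul]; norm_num
  rw [p4]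
  push_cast
  have s4 : (2 * (j:ℝ) / exp 1)^(2*j) = 2^(2*j) * ((j/exp 1)^j)^2 := by
    rw [mul_div_assoc, mul_pow, ← pow_mul, mul_comm j 2]
  rw [s4]
  have hx : 0 < ((j:ℝ)/exp 1)^j := by positivity
  generalize ((j:ℝ)/exp 1)^j = x at hx
  have hsj : 0 < √(j:ℝ) := by positivity
  generalize √(j:ℝ) = y at *
  rw [← s3]
  field_simp

lemma ratio_tendsto (f : ℕ → ℕ) (c : ℕ) (hc : 0 < c) (h : ∀ n, c * f n ≤ n + 8 ∧ n ≤ c * f n + 8) :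
    Tendsto (fun n : ℕ => (f n : ℝ) / n) atTop (𝓝 (1/c)) := by
  have hcr : (0:ℝ) < c := by exact_mod_cast hc
  have t8 : Tendsto (fun n : ℕ => (8:ℝ) / n) atTop (𝓝 0) := tendsto_const_div_atTop_nhds_zero_nat 8
  have lo : Tendsto (fun n : ℕ => (1 - (8:ℝ) / n) / c) atTop (𝓝 (1/c)) := by
    simpa using (t8.const_sub 1).div_const (c:ℝ)
  have hi : Tendsto (fun n : ℕ => (1 + (8:ℝ) / n) / c) atTop (𝓝 (1/c)) := by
    simpa using (t8.const_add 1).div_const (c:ℝ)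
  refine tendsto_of_tendsto_of_tendsto_of_le_of_le' lo hi ?_ ?_
  · filter_upwards [eventually_ge_atTop 1] with n hn
    have hnr : (0:ℝ) < n := by exact_mod_cast hn
    have : (n:ℝ) ≤ c * f n + 8 := by exact_mod_cast (h n).2
    rw [div_le_div_iff₀ hcr hnr, sub_mul, div_mul_cancel₀ _ hnr.ne']
    linarith
  · filter_upwards [eventually_ge_atTop 1] with n hn
    have hnr : (0:ℝ) < n := by exact_mod_cast hn
    have : (c:ℝ) * f n ≤ n + 8 := by exact_mod_cast (h n).1
    rw [div_le_div_iff₀ hnr hcr, add_mul, div_mul_cancel₀ _ hnr.ne']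
    linarith

lemma f_atTop (f : ℕ → ℕ) (c : ℕ) (h : ∀ n, c * f n ≤ n + 8 ∧ n ≤ c * f n + 8) :
    Tendsto f atTop atTop := by
  rw [tendsto_atTop]
  intro b
  filter_upwards [eventually_ge_atTop (c * b + 9)] with n hn
  by_contra hb
  have := (h n).2
  have := Nat.mul_le_mul_left c (show f n ≤ b by omega)
  omega

/-- halves of `N = n - 2`, etc. -/
def j1 (n : ℕ) : ℕ := ((n-2)/2+1)/2
def j2 (n : ℕ) : ℕ := ((n-2) - (n-2)/2+1)/2
def j3 (n : ℕ) : ℕ := (n-2+1)/2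

lemma upper_pointwise (n : ℕ) (hn : 3 ≤ n) :
    cConst n ≤ (n:ℝ)/(2*(n-1)) * (tc (j1 n) * tc (j2 n) / tc (j3 n)) := by
  obtain ⟨N, rfl⟩ : ∃ N, n = N + 2 := ⟨n-2, by omega⟩
  obtain ⟨H, hH⟩ : ∃ H, H = N/2 := ⟨_, rfl⟩
  obtain ⟨J, hJ⟩ : ∃ J, N = H + J := ⟨N - H, by omega⟩
  obtain ⟨v, hv, hs⟩ := (snBil_mode H J H (by omega) (by omega)).2
  have hle : cConst (N+2) ≤ snBil (H+J+2) (zvec (H+J+2) (H+1)) (zvec (H+J+2) (H+1)) := by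
    unfold cConst
    apply csInf_le
    · refine ⟨0, ?_⟩
      rintro r ⟨h, k, -, -, -, -, rfl⟩
      unfold snBil
      positivity
    · exact ⟨H+1, H+1, by omega, by omega, by omega, by omega, by rw [hJ]⟩
  refine hle.trans ?_
  rw [hs]
  have eN : ((N + 2 : ℕ):ℝ) = H + J + 2 := by rw [hJ]; push_cast; ring
  rw [eN, show (H:ℝ)+J+2-1 = H+J+1 by ring]
  apply mul_le_mul_of_nonneg_left _ (by positivity)
  have g1 : j1 (N+2) = (H+1)/2 := by unfold j1; omega
  have g2 : j2 (N+2) = (J+1)/2 := by unfold j2; omega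
  have g3 : j3 (N+2) = (N+1)/2 := by unfold j3; omega
  have c1 := choose_half H
  have c2 := choose_half J
  have c3 := choose_half N
  rw [← g1] at c1
  rw [← g2] at c2
  rw [← g3, ← hH] at c3
  have b1 : (H.choose v : ℝ) ≤ H.choose (H/2) := by exact_mod_cast Nat.choose_le_middle v H
  have b2 : (J.choose (H-v) : ℝ) ≤ J.choose (J/2) := by exact_mod_cast Nat.choose_le_middle (H-v) J
  rw [← hJ]
  calc (H.choose v : ℝ) * J.choose (H-v) / N.choose H ≤ H.choose (H/2) * J.choose (J/2) / N.choose H := by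
        gcongr
    _ = _ := by
      rw [c1, c2, c3, show (2:ℝ)^N = 2^H * 2^J by rw [hJ, pow_add]]
      have : 0 < tc (j3 (N+2)) := by
        unfold tc
        have : (0:ℝ) < (j3 (N+2)).centralBinom := by exact_mod_cast Nat.centralBinom_pos _
        positivity
      field_simp

lemma upper_tendsto : Tendsto (fun n : ℕ => (n:ℝ)/(2*(n-1)) * (tc (j1 n) * tc (j2 n) / tc (j3 n)) *
    √(π * n / 2)) atTop (𝓝 1) := by
  have a1 : ∀ n, 4 * j1 n ≤ n + 8 ∧ n ≤ 4 * j1 n + 8 := fun n => by unfold j1; omega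
  have a2 : ∀ n, 4 * j2 n ≤ n + 8 ∧ n ≤ 4 * j2 n + 8 := fun n => by unfold j2; omega
  have a3 : ∀ n, 2 * j3 n ≤ n + 8 ∧ n ≤ 2 * j3 n + 8 := fun n => by unfold j3; omega
  have t1 := tc_tendsto.comp (f_atTop j1 4 a1)
  have t2 := tc_tendsto.comp (f_atTop j2 4 a2)
  have t3 := tc_tendsto.comp (f_atTop j3 2 a3)
  have r1 := ratio_tendsto j1 4 (by norm_num) a1
  have r2 := ratio_tendsto j2 4 (by norm_num) a2
  have r3 := ratio_tendsto j3 2 (by norm_num) a3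
  have r0 := ratio_tendsto (fun n => n - 1) 1 (by norm_num) (fun n => by omega)
  have T := (((t1.mul t2).div t3 (by positivity)).mul
    (((r3.div (r1.mul r2) (by norm_num)).const_mul (π/2)).sqrt)).div (r0.const_mul 2) (by norm_num)
  have lim : 1 / √π * (1 / √π) / (1/√π) * √(π/2 * (1/(2:ℕ) / (1/(4:ℕ) * (1/(4:ℕ))))) / (2 * (1/(1:ℕ))) = 1 := by
    push_cast
    rw [show π/2 * (1/2 / (1/4 * (1/4))) = 2^2 * π by ring, sqrt_mul (by norm_num), sqrt_sq (by norm_num)]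
    field_simp
  rw [lim] at T
  refine T.congr' ?_
  filter_upwards [eventually_ge_atTop 20] with n hn
  have hnr : (0:ℝ) < n := by exact_mod_cast (by omega : 0 < n)
  have p1 : (0:ℝ) < j1 n := by exact_mod_cast (by have := a1 n; omega : 0 < j1 n)
  have p2 : (0:ℝ) < j2 n := by exact_mod_cast (by have := a2 n; omega : 0 < j2 n)
  have p3 : (0:ℝ) < j3 n := by exact_mod_cast (by have := a3 n; omega : 0 < j3 n)
  have hn1 : (((n - 1 : ℕ)):ℝ) = n - 1 := by rw [Nat.cast_sub (by omega)]; norm_num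
  have hn1p : (0:ℝ) < (n:ℝ) - 1 := by rw [← hn1]; exact_mod_cast (by omega : 0 < n - 1)
  simp only [Pi.div_apply, Pi.mul_apply, Function.comp]
  rw [hn1]
  have es : √(π/2 * ((j3 n:ℝ)/n / ((j1 n:ℝ)/n * ((j2 n:ℝ)/n)))) = √(π*n/2) * √(j3 n) / (√(j1 n) * √(j2 n)) := by
    rw [← sqrt_mul (by positivity), ← sqrt_mul (by positivity), ← sqrt_div (by positivity)]
    congr 1
    field_simp
  rw [es]
  have q1 : 0 < √(j1 n:ℝ) := by positivity
  have q2 : 0 < √(j2 n:ℝ) := by positivity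
  have q3 : 0 < √(j3 n:ℝ) := by positivity
  have q4 : 0 < tc (j3 n) := by
    unfold tc
    have : (0:ℝ) < (j3 n).centralBinom := by exact_mod_cast Nat.centralBinom_pos _
    positivity
  field_simp

/-- The sequence `cₙ·√(πn/2)` converges to `1`. -/
theorem stmt_11 :
    Filter.Tendsto (fun n : ℕ => cConst n * Real.sqrt (Real.pi * n / 2))
      Filter.atTop (nhds 1) := by
  rw [tendsto_order]
  constructor
  · intro a ha
    obtain ⟨ε, h1, h2, h3⟩ : ∃ ε : ℝ, 0 < ε ∧ ε < 1 ∧ a < 1 - ε :=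
      ⟨min ((1-a)/2) (1/2), lt_min (by linarith) (by norm_num),
        lt_of_le_of_lt (min_le_right _ _) (by norm_num), by
        have := min_le_left ((1-a)/2) (1/2); linarith⟩
    filter_upwards [lower_bound ε h1 h2] with n hn
    exact h3.trans_le hn
  · intro a ha
    filter_upwards [upper_tendsto.eventually (gt_mem_nhds ha), eventually_ge_atTop 3] with n hn hn3
    exact lt_of_le_of_lt (mul_le_mul_of_nonneg_right (upper_pointwise n hn3) (by positivity)) hn
end
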